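/- arXiv:q-alg/9608023 — 2 statements merged into one kernel-verified Lean document; each statement's English description precedes it below -/
import Mathlib

section
/- Let L be a unimodular lattice in ℝ^n having no vectors of norm 1. Then the set {x ∈ L : ⟪x,x⟫ = 2} is finite and its cardinality N₂ satisfies N₂ ≥ 2n(23 − n) (as an inequality of integers). -/
open scoped RealInnerProductSpace

/-- A unimodular (self-dual) lattice in `ℝⁿ`: a `ℤ`-submodule of Euclidean space that is
discrete, spans `ℝⁿ` over `ℝ`, and is self-dual: a vector `v` belongs to the lattice iff
its inner product with every lattice vector is an integer. -/
def IsUnimodularLattice (n : ℕ) (L : Submodule ℤ (EuclideanSpace ℝ (Fin n))) : Prop :=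
  DiscreteTopology L ∧
  Submodule.span ℝ (L : Set (EuclideanSpace ℝ (Fin n))) = ⊤ ∧
  ∀ v : EuclideanSpace ℝ (Fin n), v ∈ L ↔ ∀ y ∈ L, ∃ k : ℤ, ⟪v, y⟫ = (k : ℝ)

/-- A characteristic vector of a lattice `L`: a vector `w ∈ L` with
`⟪w,x⟫ ≡ ⟪x,x⟫ (mod 2)` for all `x ∈ L`. -/
def IsCharacteristic (n : ℕ) (L : Submodule ℤ (EuclideanSpace ℝ (Fin n)))
    (w : EuclideanSpace ℝ (Fin n)) : Prop :=
  w ∈ L ∧ ∀ x ∈ L, ∃ k : ℤ, ⟪w, x⟫ - ⟪x, x⟫ = 2 * (k : ℝ)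

section Part1
open scoped RealInnerProductSpace
open MeasureTheory Complex Set

namespace Elkies

/-- Unfolding an integral over `ℝ^d` into a sum over integer translates of the unit cube. -/
lemma integral_unfold {d : Type*} [Fintype d] (g : (d → ℝ) → ℂ) (hg : Integrable g) :
    HasSum (fun m : d → ℤ => ∫ x in {x : d → ℝ | ∀ i, x i ∈ Ioc (0 : ℝ) (0 + 1)},
      g (x + fun i => (m i : ℝ))) (∫ x, g x) := by
  set B : Set (d → ℝ) := {x : d → ℝ | ∀ i, x i ∈ Ioc (0 : ℝ) (0 + 1)} with hB
  have hBm : MeasurableSet B := by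
    have : B = Set.pi univ (fun _ => Ioc (0 : ℝ) (0 + 1)) := by ext x; simp [hB]
    rw [this]
    exact MeasurableSet.univ_pi (fun _ => measurableSet_Ioc)
  let S : (d → ℤ) → Set (d → ℝ) := fun m => (fun x => x + fun i => -(m i : ℝ)) ⁻¹' B
  have hSm : ∀ m, MeasurableSet (S m) := fun m => hBm.preimage (measurable_add_const _)
  have hmem : ∀ m x, x ∈ S m ↔ ∀ i, (m i : ℝ) < x i ∧ x i ≤ m i + 1 := by
    intro m x
    simp only [S, hB, mem_preimage, mem_ofPred_eq, mem_Ioc, Pi.add_apply]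
    refine forall_congr' fun i => ⟨fun h => ⟨by linarith [h.1], by linarith [h.2]⟩,
      fun h => ⟨by linarith [h.1], by linarith [h.2]⟩⟩
  have hdisj : Pairwise (Function.onFun Disjoint S) := by
    intro m m' hne
    refine Set.disjoint_left.2 fun x hx hx' => hne ?_
    rw [hmem] at hx hx'
    funext i
    have h1 : m i < m' i + 1 := by exact_mod_cast (hx i).1.trans_le (hx' i).2
    have h2 : m' i < m i + 1 := by exact_mod_cast (hx' i).1.trans_le (hx i).2
    omega
  have hun : (⋃ m, S m) = univ := by
    refine eq_univ_of_forall fun x => mem_iUnion.2 ⟨fun i => ⌈x i⌉ - 1, ?_⟩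
    rw [hmem]
    intro i
    push_cast
    exact ⟨by linarith [Int.ceil_lt_add_one (x i)], by linarith [Int.le_ceil (x i)]⟩
  have := hasSum_integral_iUnion (μ := volume) (f := g) hSm hdisj hg.integrableOn
  rw [hun, setIntegral_univ] at this
  refine this.congr_fun ?_ |> fun h => h
  intro m
  have h := (measurePreserving_add_right (volume : Measure (d → ℝ))
    (fun i => -(m i : ℝ))).setIntegral_preimage_emb
    (MeasurableEquiv.addRight (fun i => -(m i : ℝ))).measurableEmbedding
    (fun x => g (x + fun i => (m i : ℝ))) B
  rw [← h]
  refine setIntegral_congr_fun (hSm m) fun x _ => ?_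
  congr 1
  ext i
  simp

/-- Poisson summation on `ℤ^d`. -/
lemma poisson_pi {d : Type*} [Fintype d] (f : (d → ℝ) → ℂ) (hc : Continuous f)
    (hintg : Integrable f)
    (hsum : ∀ R : ℝ, ∃ u : (d → ℤ) → ℝ, Summable u ∧
      ∀ x : d → ℝ, ‖x‖ ≤ R → ∀ k : d → ℤ, ‖f (x + fun i => (k i : ℝ))‖ ≤ u k)
    (hF : Summable fun k : d → ℤ => ∫ y, cexp (-(2 * Real.pi * I * ((∑ i, (k i : ℝ) * y i : ℝ) : ℂ))) * f y)
    (x : d → ℝ) :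
    ∑' k : d → ℤ, f (x + fun i => (k i : ℝ)) =
      ∑' k : d → ℤ, (∫ y, cexp (-(2 * Real.pi * I * ((∑ i, (k i : ℝ) * y i : ℝ) : ℂ))) * f y) *
        cexp (2 * Real.pi * I * ((∑ i, (k i : ℝ) * x i : ℝ) : ℂ)) := by
  classical
  let G : (d → ℝ) → ℂ := fun x => ∑' k : d → ℤ, f (x + fun i => (k i : ℝ))
  let p : (d → ℝ) → UnitAddTorus d := fun x i => (x i : UnitAddCircle)
  have hGc : Continuous G := by
    refine continuous_iff_continuousAt.2 fun x => ?_
    obtain ⟨u, hu, hb⟩ := hsum (‖x‖ + 1)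
    have : ContinuousOn G (Metric.closedBall 0 (‖x‖ + 1)) := by
      refine continuousOn_tsum (fun k => ?_) hu (fun k y hy => hb y (by simpa using hy) k)
      exact (hc.comp (continuous_id.add continuous_const)).continuousOn
    refine this.continuousAt (Filter.mem_of_superset (Metric.ball_mem_nhds x one_pos) ?_)
    intro y hy
    have h1 : ‖y - x‖ < 1 := by simpa [dist_eq_norm] using hy
    have h2 := norm_add_le (y - x) x
    simp only [sub_add_cancel] at h2
    simp; linarith
  have hGp : ∀ x (m : d → ℤ), G (x + fun i => (m i : ℝ)) = G x := by
    intro x m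
    simp only [G]
    rw [← (Equiv.addLeft m).tsum_eq (fun k : d → ℤ => f (x + fun i => (k i : ℝ)))]
    refine tsum_congr fun k => ?_
    congr 1
    ext i
    simp [add_assoc]
  have hp : IsOpenQuotientMap p :=
    IsOpenQuotientMap.piMap (fun _ => QuotientAddGroup.isOpenQuotientMap_mk)
  have hlift : ∀ x y, p x = p y → G x = G y := by
    intro x y hxy
    have : ∀ i, ∃ m : ℤ, x i = y i + m := by
      intro i
      have h := congrFun hxy i
      simp only [p] at h
      rw [← sub_eq_zero, ← AddCircle.coe_sub, AddCircle.coe_eq_zero_iff] at h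
      obtain ⟨n, hn⟩ := h
      exact ⟨n, by simp at hn; linarith⟩
    choose m hm using this
    rw [← hGp y m]
    congr 1
    ext i
    exact hm i
  let F : C(UnitAddTorus d, ℂ) := 
    Topology.IsQuotientMap.lift (f := ⟨p, hp.continuous⟩) hp.isQuotientMap ⟨G, hGc⟩
      (fun x y h => hlift x y h)
  have hFp : ∀ x, F (p x) = G x := fun x => by
    exact congrArg (fun h : C(_, _) => h x)
      (Topology.IsQuotientMap.lift_comp (f := ⟨p, hp.continuous⟩) hp.isQuotientMap ⟨G, hGc⟩
        (fun x y h => hlift x y h))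
  have hmF : ∀ (k : d → ℤ) (y : d → ℝ), UnitAddTorus.mFourier k (p y) =
      cexp (2 * Real.pi * I * ((∑ i, (k i : ℝ) * y i : ℝ) : ℂ)) := by
    intro k y
    simp only [UnitAddTorus.mFourier, ContinuousMap.coe_mk, p, fourier_coe_apply, 
      ofReal_sum, Finset.mul_sum, Complex.exp_sum]
    refine Finset.prod_congr rfl fun i _ => ?_
    congr 1
    push_cast
    ring
  have hcoef : ∀ k, UnitAddTorus.mFourierCoeff F k =
      ∫ y, cexp (-(2 * Real.pi * I * ((∑ i, (k i : ℝ) * y i : ℝ) : ℂ))) * f y := by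
    intro k
    rw [UnitAddTorus.mFourierCoeff_eq_integral _ _ 0]
    have hee : ∀ y : d → ℝ, ‖cexp (-(2 * Real.pi * I * ((∑ i, (k i : ℝ) * y i : ℝ) : ℂ)))‖ = 1 := by
      intro y
      rw [Complex.norm_exp]
      simp
    have hec : Continuous fun y : d → ℝ =>
        cexp (-(2 * Real.pi * I * ((∑ i, (k i : ℝ) * y i : ℝ) : ℂ))) := by fun_prop
    have hgi : Integrable fun y : d → ℝ =>
        cexp (-(2 * Real.pi * I * ((∑ i, (k i : ℝ) * y i : ℝ) : ℂ))) * f y :=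
      hintg.bdd_mul hec.aestronglyMeasurable (c := 1) (Filter.Eventually.of_forall fun y => (hee y).le)
    have hper : ∀ (y : d → ℝ) (m : d → ℤ),
        cexp (-(2 * Real.pi * I * ((∑ i, (k i : ℝ) * (y + fun i => (m i : ℝ)) i : ℝ) : ℂ))) =
        cexp (-(2 * Real.pi * I * ((∑ i, (k i : ℝ) * y i : ℝ) : ℂ))) := by
      intro y m
      rw [Complex.exp_eq_exp_iff_exists_int]
      refine ⟨-∑ i, k i * m i, ?_⟩
      push_cast
      simp only [Pi.add_apply, ofReal_add, mul_add, Finset.sum_add_distrib, ofReal_intCast]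
      ring
    have hu := integral_unfold _ hgi
    rw [← hu.tsum_eq]
    obtain ⟨u, hus, hub⟩ := hsum 1
    simp only [hper]
    set B : Set (d → ℝ) := {x : d → ℝ | ∀ i, x i ∈ Ioc (0 : ℝ) (0 + 1)} with hB
    have hB' : B = Set.pi univ (fun _ => Ioc (0 : ℝ) (0 + 1)) := by ext x; simp [hB]
    have hBm : MeasurableSet B := by
      rw [hB']
      exact MeasurableSet.univ_pi (fun _ => measurableSet_Ioc)
    have hBf : volume B < ⊤ := by
      rw [hB', volume_pi_pi]
      simp
    have hBn : ∀ x ∈ B, ‖x‖ ≤ 1 := by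
      intro x hx
      refine (pi_norm_le_iff_of_nonneg zero_le_one).2 fun i => ?_
      have := hx i
      rw [Real.norm_eq_abs, abs_of_pos this.1]
      simpa using this.2
    have hb : ∀ (m : d → ℤ), ∀ x ∈ B,
        ‖cexp (-(2 * Real.pi * I * ((∑ i, (k i : ℝ) * x i : ℝ) : ℂ))) *
          f (x + fun i => (m i : ℝ))‖ ≤ u m := by
      intro m x hx
      rw [norm_mul, hee, one_mul]
      exact hub x (hBn x hx) m
    have hci : ∀ m : d → ℤ, Continuous fun x : d → ℝ =>
        cexp (-(2 * Real.pi * I * ((∑ i, (k i : ℝ) * x i : ℝ) : ℂ))) *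
          f (x + fun i => (m i : ℝ)) := fun m =>
      hec.mul (hc.comp (continuous_id.add continuous_const))
    have hii : ∀ m : d → ℤ, IntegrableOn (fun x : d → ℝ =>
        cexp (-(2 * Real.pi * I * ((∑ i, (k i : ℝ) * x i : ℝ) : ℂ))) *
          f (x + fun i => (m i : ℝ))) B := by
      intro m
      refine Measure.integrableOn_of_bounded (M := u m) hBf.ne (hci m).aestronglyMeasurable ?_
      exact (ae_restrict_mem hBm).mono fun x hx => hb m x hx
    have hs := hasSum_integral_of_summable_integral_norm (μ := volume.restrict B)
      (F := fun (m : d → ℤ) (x : d → ℝ) =>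
        cexp (-(2 * Real.pi * I * ((∑ i, (k i : ℝ) * x i : ℝ) : ℂ))) *
          f (x + fun i => (m i : ℝ))) hii ?_
    · rw [hs.tsum_eq]
      refine setIntegral_congr_fun hBm fun x hx => ?_
      have hx' := hFp x
      simp only [p] at hx'
      have hm' := hmF (-k) x
      simp only [p] at hm'
      simp only [hx', hm', smul_eq_mul, G]
      rw [tsum_mul_left]
      congr 2
      simp
    · refine Summable.of_nonneg_of_le (fun m => integral_nonneg fun x => norm_nonneg _)
        (fun m => ?_) (hus.mul_right (volume.real B))
      have := norm_setIntegral_le_of_norm_le_const (μ := volume) (s := B) (C := u m)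
        (f := fun x : d → ℝ => ‖cexp (-(2 * Real.pi * I * ((∑ i, (k i : ℝ) * x i : ℝ) : ℂ))) *
          f (x + fun i => (m i : ℝ))‖) hBf (fun x hx => by rw [norm_norm]; exact hb m x hx)
      exact (Real.le_norm_self _).trans this
  have h := UnitAddTorus.hasSum_mFourier_series_apply_of_summable (f := F)
    (by simpa only [funext hcoef] using hF) (p x)
  rw [hFp] at h
  refine h.tsum_eq.symm.trans (tsum_congr fun k => ?_)
  rw [hcoef, hmF, smul_eq_mul]

end Elkies
end Part1

section Part2
open scoped RealInnerProductSpace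
open MeasureTheory Complex Set

namespace Elkies

section lattice
variable {E : Type*} [NormedAddCommGroup E] [InnerProductSpace ℝ E] [FiniteDimensional ℝ E]

lemma summable_gauss (L : Submodule ℤ E) [DiscreteTopology L] {c : ℝ} (hc : 0 < c) :
    Summable fun x : L => Real.exp (-c * ‖(x : E)‖ ^ 2) := by
  set N := Module.finrank ℤ L + 1 with hN
  have h1 := (ZLattice.summable_norm_pow_inv L (2 * N) (by omega)).mul_left
    ((N.factorial : ℝ) / c ^ N)
  refine Summable.of_norm_bounded_eventually h1 ?_
  have : ({0}ᶜ : Set L) ∈ Filter.cofinite := by simp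
  filter_upwards [this] with x hx
  have hx0 : 0 < ‖(x : E)‖ := by
    rw [norm_pos_iff]
    intro h
    exact hx (by ext; simpa using h)
  rw [Real.norm_eq_abs, abs_of_pos (Real.exp_pos _), neg_mul, Real.exp_neg]
  have h2 := Real.pow_div_factorial_le_exp (c * ‖(x : E)‖ ^ 2) (by positivity) N
  have h3 : (N.factorial : ℝ) / c ^ N * ‖x‖⁻¹ ^ (2 * N) =
      ((c * ‖(x : E)‖ ^ 2) ^ N / N.factorial)⁻¹ := by
    rw [inv_div, mul_pow, ← pow_mul, inv_pow, div_mul_eq_div_div, div_eq_mul_inv _ (‖(x:E)‖ ^ _)]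
    rfl
  rw [h3]
  exact inv_anti₀ (by positivity) h2

variable [MeasurableSpace E] [BorelSpace E]

lemma exists_dual_equiv (L : Submodule ℤ E) {ι : Type*} [Fintype ι]
    (β : Module.Basis ι ℤ L) (bR : Module.Basis ι ℝ E) (hb : ∀ i, bR i = (β i : E))
    (hdual : ∀ v : E, v ∈ L ↔ ∀ y ∈ L, ∃ k : ℤ, ⟪v, y⟫ = (k : ℝ)) :
    ∃ e : (ι → ℤ) ≃ L, ∀ (k : ι → ℤ) (x : ι → ℝ),
      ⟪(e k : E), bR.equivFun.symm x⟫ = ∑ i, (k i : ℝ) * x i := by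
  classical
  have h1 : ∀ k : ι → ℤ, ∃ v : L, ∀ i, ⟪(v : E), bR i⟫ = (k i : ℝ) := by
    intro k
    let φ : E →L[ℝ] ℝ := LinearMap.toContinuousLinearMap (bR.constr ℝ (fun i => (k i : ℝ)))
    let v := (InnerProductSpace.toDual ℝ E).symm φ
    have hv : ∀ x, ⟪v, x⟫ = φ x := fun x => InnerProductSpace.toDual_symm_apply
    have hvi : ∀ i, ⟪v, bR i⟫ = (k i : ℝ) := by
      intro i
      rw [hv]
      simp [φ]
    refine ⟨⟨v, (hdual v).2 fun y hy => ?_⟩, hvi⟩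
    have hy' : y = ∑ i, (β.repr ⟨y, hy⟩ i : ℝ) • bR i := by
      have := congrArg (Subtype.val) (β.sum_repr ⟨y, hy⟩)
      simp only at this
      refine this.symm.trans ?_
      rw [Submodule.coe_sum]
      refine Finset.sum_congr rfl fun i _ => ?_
      rw [hb, Int.cast_smul_eq_zsmul, Submodule.coe_smul]
    refine ⟨∑ i, β.repr ⟨y, hy⟩ i * k i, ?_⟩
    have h3 : ⟪v, y⟫ = ⟪v, ∑ i, (β.repr ⟨y, hy⟩ i : ℝ) • bR i⟫ := congrArg _ hy'
    rw [h3, inner_sum]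
    push_cast
    refine Finset.sum_congr rfl fun i _ => ?_
    rw [inner_smul_right, hvi]
  choose e he using h1
  have hinj : Function.Injective e := by
    intro k k' h
    funext i
    have h2 := he k i
    rw [h, he k' i] at h2
    exact_mod_cast h2.symm
  have hsurj : Function.Surjective e := by
    intro v
    have : ∀ i, ∃ k : ℤ, ⟪(v : E), bR i⟫ = (k : ℝ) := by
      intro i
      rw [hb]
      exact (hdual v).1 v.2 _ (β i).2
    choose k hk using this
    refine ⟨k, Subtype.ext ?_⟩
    refine InnerProductSpace.ext_inner_right_basis bR fun i => ?_
    rw [he, hk]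
  refine ⟨Equiv.ofBijective e ⟨hinj, hsurj⟩, fun k x => ?_⟩
  change ⟪(e k : E), _⟫ = _
  simp only [Module.Basis.equivFun_symm_apply, inner_sum, inner_smul_right, he]
  exact Finset.sum_congr rfl fun i _ => mul_comm _ _

lemma poisson_lattice (L : Submodule ℤ E) [DiscreteTopology L] [IsZLattice ℝ L]
    (hdual : ∀ v : E, v ∈ L ↔ ∀ y ∈ L, ∃ k : ℤ, ⟪v, y⟫ = (k : ℝ)) :
    ∃ c : ℝ, 0 < c ∧ ∀ b : ℂ, 0 < b.re → ∀ u : E,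
      ∑' x : L, cexp (-(Real.pi * b) * (‖u + (x : E)‖ : ℂ) ^ 2) =
        c * (1 / b) ^ (Module.finrank ℝ E / 2 : ℂ) *
          ∑' y : L, cexp (-Real.pi * (‖(y : E)‖ : ℂ) ^ 2 / b) *
            cexp (2 * Real.pi * I * (⟪(y : E), u⟫ : ℝ)) := by
  classical
  let ι := Module.Free.ChooseBasisIndex ℤ L
  let β : Module.Basis ι ℤ L := Module.Free.chooseBasis ℤ L
  let bR : Module.Basis ι ℝ E := β.ofZLatticeBasis ℝ L
  have hb : ∀ i, bR i = (β i : E) := fun i => β.ofZLatticeBasis_apply ℝ L i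
  obtain ⟨e, he⟩ := exists_dual_equiv L β bR hb hdual
  let A : (ι → ℝ) ≃L[ℝ] E := bR.equivFun.symm.toContinuousLinearEquiv
  have hA : ∀ x, A x = bR.equivFun.symm x := fun x => rfl
  have hAk : ∀ k : ι → ℤ, A (fun i => (k i : ℝ)) = (β.equivFun.symm k : E) := by
    intro k
    rw [hA, Module.Basis.equivFun_symm_apply, Module.Basis.equivFun_symm_apply]
    simp [hb, Int.cast_smul_eq_zsmul]
  -- measure
  have hmap : (volume.map A : Measure E).IsAddHaarMeasure :=
    ContinuousLinearEquiv.isAddHaarMeasure_map A volume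
  let c : NNReal := (volume.map A : Measure E).addHaarScalarFactor volume
  have hc : (volume.map A : Measure E) = c • volume :=
    Measure.isAddLeftInvariant_eq_smul _ _
  have hcpos : 0 < c := Measure.addHaarScalarFactor_pos_of_isAddHaarMeasure _ _
  have hchange : ∀ g : E → ℂ, ∫ x, g (A x) = (c : ℝ) * ∫ v, g v := by
    intro g
    have := (A.toHomeomorph.measurableEmbedding.integral_map (μ := volume) g)
    have h2 : (Measure.map (⇑A.toHomeomorph) volume) = (volume.map A : Measure E) := rfl
    rw [h2, hc, integral_smul_nnreal_measure] at this
    rw [NNReal.smul_def, Complex.real_smul] at this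
    exact this.symm
  refine ⟨c, by exact_mod_cast hcpos, fun b hbre u => ?_⟩
  have hπb : 0 < ((Real.pi : ℂ) * b).re := by
    rw [Complex.re_ofReal_mul]; positivity
  let f : (ι → ℝ) → ℂ := fun x => cexp (-(Real.pi * b) * (‖A x‖ : ℂ) ^ 2)
  have hfn : ∀ x, ‖f x‖ = Real.exp (-(Real.pi * b.re) * ‖A x‖ ^ 2) := by
    intro x
    simp only [f, Complex.norm_exp]
    congr 1
    rw [← ofReal_pow, mul_comm, re_ofReal_mul, neg_re, re_ofReal_mul]
    ring
  have hfc : Continuous f := by fun_prop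
  have hfi : Integrable f := by
    have h0 := GaussianFourier.integrable_cexp_neg_mul_sq_norm_add (V := E) hπb 0 0
    have h1 : Integrable (fun v : E => cexp (-(Real.pi * b) * (‖v‖ : ℂ) ^ 2)) (volume.map A) := by
      rw [hc]
      refine Integrable.smul_measure_nnreal ?_
      simpa using h0
    exact (A.toHomeomorph.measurableEmbedding.integrable_map_iff (μ := volume)).1 h1
  have hFT : ∀ k : ι → ℤ, ∫ y, cexp (-(2 * Real.pi * I * ((∑ i, (k i : ℝ) * y i : ℝ) : ℂ))) * f y =
      (c : ℝ) * (1 / b) ^ (Module.finrank ℝ E / 2 : ℂ) *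
        cexp (-Real.pi * (‖(e k : E)‖ : ℂ) ^ 2 / b) := by
    intro k
    have h1 : ∀ y : ι → ℝ, cexp (-(2 * Real.pi * I * ((∑ i, (k i : ℝ) * y i : ℝ) : ℂ))) * f y =
      (fun v : E => cexp (-(Real.pi * b) * (‖v‖ : ℂ) ^ 2 + (-(2 * Real.pi * I)) * (⟪(e k : E), v⟫ : ℝ))) (A y) := by
      intro y
      simp only [f]
      rw [← Complex.exp_add, hA, he]
      congr 1
      ring
    simp only [h1]
    rw [hchange (fun v : E => cexp (-(Real.pi * b) * (‖v‖ : ℂ) ^ 2 + (-(2 * Real.pi * I)) * (⟪(e k : E), v⟫ : ℝ)))]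
    rw [GaussianFourier.integral_cexp_neg_mul_sq_norm_add hπb]
    have hb0 : b ≠ 0 := by rintro rfl; simp at hbre
    have hp0 : (Real.pi : ℂ) ≠ 0 := by exact_mod_cast Real.pi_ne_zero
    have e1 : (Real.pi : ℂ) / (Real.pi * b) = 1 / b := by field_simp
    have e2 : (-(2 * Real.pi * I)) ^ 2 * (‖(e k : E)‖ : ℂ) ^ 2 / (4 * (Real.pi * b)) =
        -Real.pi * (‖(e k : E)‖ : ℂ) ^ 2 / b := by
      field_simp
      rw [I_sq]
      ring
    rw [e1, e2, mul_assoc]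
  have hsum1 : ∀ {a : ℝ}, 0 < a → Summable fun k : ι → ℤ =>
      Real.exp (-a * ‖A (fun i => (k i : ℝ))‖ ^ 2) := by
    intro a ha
    have := (β.equivFun.symm.toEquiv.summable_iff).2 (summable_gauss L ha)
    refine this.congr fun k => ?_
    simp [hAk]
  have hP := poisson_pi f hfc hfi ?_ ?_ (A.symm u)
  · have hl : ∑' x : L, cexp (-(Real.pi * b) * (‖u + (x : E)‖ : ℂ) ^ 2) =
        ∑' k : ι → ℤ, f (A.symm u + fun i => (k i : ℝ)) := by
      rw [← β.equivFun.symm.toEquiv.tsum_eq]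
      refine tsum_congr fun k => ?_
      simp only [f, map_add, A.apply_symm_apply, hAk]
      rfl
    rw [hl, hP, ← tsum_mul_left, ← e.tsum_eq]
    refine tsum_congr fun k => ?_
    rw [hFT, ← he, ← hA, A.apply_symm_apply]
    ring
  · intro R
    refine ⟨fun k => Real.exp (Real.pi * b.re * (‖(A : (ι → ℝ) →L[ℝ] E)‖ * R) ^ 2) *
      Real.exp (-(Real.pi * b.re / 2) * ‖A (fun i => (k i : ℝ))‖ ^ 2),
      (hsum1 (by positivity)).mul_left _, fun x hx k => ?_⟩
    beta_reduce
    rw [hfn, ← Real.exp_add]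
    refine Real.exp_le_exp.2 ?_
    set y := A (fun i => (k i : ℝ))
    have h1 : ‖A x‖ ≤ ‖(A : (ι → ℝ) →L[ℝ] E)‖ * R :=
      ((A : (ι → ℝ) →L[ℝ] E).le_opNorm x).trans (by gcongr)
    have h2 : ‖A x‖ ^ 2 ≤ (‖(A : (ι → ℝ) →L[ℝ] E)‖ * R) ^ 2 := by gcongr
    have h3 : ‖y‖ ≤ ‖A x + y‖ + ‖A x‖ := by
      have := norm_sub_le (A x + y) (A x)
      simpa using this
    have h4 : ‖y‖ ^ 2 ≤ 2 * ‖A x + y‖ ^ 2 + 2 * ‖A x‖ ^ 2 := by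
      have := norm_nonneg y
      nlinarith [sq_nonneg (‖A x + y‖ - ‖A x‖)]
    have h5 : 0 < Real.pi * b.re := by positivity
    rw [map_add]
    nlinarith [mul_le_mul_of_nonneg_left h4 h5.le, mul_le_mul_of_nonneg_left h2 h5.le]
  · simp only [hFT]
    refine Summable.mul_left _ ?_
    have hb' : 0 < (1 / b).re := by
      rw [one_div, Complex.inv_re]
      refine div_pos hbre (Complex.normSq_pos.2 ?_)
      rintro rfl
      simp at hbre
    have := (e.summable_iff).2 (summable_gauss L (mul_pos Real.pi_pos hb'))
    refine Summable.of_norm (this.congr fun k => ?_)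
    simp only [Function.comp, Complex.norm_exp]
    congr 1
    rw [div_eq_mul_one_div (-(Real.pi : ℂ) * _), ← ofReal_pow, ← ofReal_neg, ← ofReal_mul, re_ofReal_mul]
    ring

end lattice
end Elkies
end Part2

section Part3
open Complex hiding I
open Filter Asymptotics ModularGroup
open UpperHalfPlane hiding I
open scoped Manifold MatrixGroups ModularForm Topology

namespace Elkies

section modular

/-- the automorphy factor `(-iτ)^{1/2}` -/
noncomputable def J (τ : ℍ) : ℂ := (-Complex.I * (τ : ℂ)) ^ (1 / 2 : ℂ)

lemma J_sq (τ : ℍ) : J τ ^ 2 = -Complex.I * τ := by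
  rw [J, ← cpow_nat_mul]
  norm_num

lemma J_eight (τ : ℍ) : J τ ^ 8 = (τ : ℂ) ^ 4 := by
  have : J τ ^ 8 = (J τ ^ 2) ^ 4 := by ring
  rw [this, J_sq, mul_pow, neg_pow, I_pow_four]
  norm_num

lemma J_ne_zero (τ : ℍ) : J τ ≠ 0 := by
  intro h
  have := J_sq τ
  rw [h] at this
  have h0 := τ.ne_zero
  simp at this
  exact h0 this

/-- weak modularity for the theta group with trivial growth at the other cusp -/
structure Wt (n : ℕ) (M : ℍ → ℂ) : Prop where
  md : MDiff M
  t2 : ∀ τ, M (T • T • τ) = M τ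
  s : ∀ τ, M (S • τ) = J τ ^ n * M τ
  cusp : (fun τ => M (T • S • τ)) =O[atImInfty] fun τ => J τ ^ n

lemma Wt.mul {n m : ℕ} {f g : ℍ → ℂ} (hf : Wt n f) (hg : Wt m g) : Wt (n + m) (f * g) where
  md := hf.md.mul hg.md
  t2 τ := by simp only [Pi.mul_apply, Pi.add_apply, hf.t2, hg.t2]
  s τ := by simp only [Pi.mul_apply, Pi.add_apply, hf.s, hg.s]; ring
  cusp := (hf.cusp.mul hg.cusp).congr_right fun τ => (pow_add _ _ _).symm

lemma Wt.add {n : ℕ} {f g : ℍ → ℂ} (hf : Wt n f) (hg : Wt n g) : Wt n (f + g) where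
  md := hf.md.add hg.md
  t2 τ := by simp only [Pi.mul_apply, Pi.add_apply, hf.t2, hg.t2]
  s τ := by simp only [Pi.mul_apply, Pi.add_apply, hf.s, hg.s]; ring
  cusp := hf.cusp.add hg.cusp

lemma Wt.smul {n : ℕ} {f : ℍ → ℂ} (hf : Wt n f) (c : ℂ) : Wt n (fun τ => c * f τ) where
  md := mdifferentiable_const.mul hf.md
  t2 τ := by simp only [Pi.mul_apply, Pi.add_apply, hf.t2]
  s τ := by simp only [Pi.mul_apply, Pi.add_apply, hf.s]; ring
  cusp := hf.cusp.const_mul_left c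

lemma Wt.one : Wt 0 1 where
  md := mdifferentiable_const
  t2 τ := rfl
  s τ := by simp
  cusp := by simpa using isBigO_refl (fun _ : ℍ => (1 : ℂ)) _

lemma Wt.pow {n : ℕ} {f : ℍ → ℂ} (hf : Wt n f) (k : ℕ) : Wt (n * k) (f ^ k) := by
  induction k with
  | zero => simpa using Wt.one
  | succ k ih => rw [pow_succ, mul_add_one]; exact ih.mul hf

lemma denom_T (τ : ℍ) : denom T τ = 1 := by rw [denom_apply]; simp [T]

lemma disc_S (τ : ℍ) : ModularForm.discriminant (S • τ) = (τ : ℂ) ^ 12 * ModularForm.discriminant τ := by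
  have := congrFun ModularForm.discriminant_S_invariant τ
  rw [ModularForm.SL_slash_apply, denom_S] at this
  have h0 := τ.ne_zero
  rw [← this, zpow_neg]
  field_simp

lemma disc_T (τ : ℍ) : ModularForm.discriminant (T • τ) = ModularForm.discriminant τ := by
  have := congrFun ModularForm.discriminant_T_invariant τ
  rw [ModularForm.SL_slash_apply, denom_T, one_zpow, mul_one] at this
  exact this

lemma md_SL (γ : SL(2, ℤ)) {f : ℍ → ℂ} (hf : MDiff f) : MDiff (fun τ => f (γ • τ)) := by
  have h := mdifferentiable_smul (g := (γ : GL (Fin 2) ℝ)) (by simp)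
  exact hf.comp h

lemma eq_zero_of_SL {f : ℍ → ℂ} (hf : MDiff f) (hS : ∀ τ, f (S • τ) = f τ)
    (hT : ∀ τ, f (T • τ) = f τ) (h0 : Tendsto f atImInfty (𝓝 0)) : f = 0 := by
  have hS' : f ∣[(0 : ℤ)] S = f := by
    ext τ; rw [ModularForm.SL_slash_apply, hS]; simp
  have hT' : f ∣[(0 : ℤ)] T = f := by
    ext τ; rw [ModularForm.SL_slash_apply, hT]; simp
  let F : ModularForm 𝒮ℒ 0 :=
    { toFun := f
      slash_action_eq' := fun A hA => by
        obtain ⟨A, rfl⟩ := hA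
        exact SlashInvariantForm.slash_action_generators_SL2Z hS' hT' A
      holo' := hf
      bdd_at_cusps' := fun hc => by
        rw [Subgroup.IsArithmetic.isCusp_iff_isCusp_SL2Z] at hc
        rw [OnePoint.isBoundedAt_iff_forall_SL2Z hc]
        intro γ _
        rw [SlashInvariantForm.slash_action_generators_SL2Z hS' hT']
        exact h0.isBigO_one ℝ }
  obtain ⟨c, hc⟩ := ModularFormClass.levelOne_weight_zero_const F
  have hc : f = Function.const _ c := hc
  have : c = 0 := by
    rw [hc] at h0
    exact tendsto_nhds_unique tendsto_const_nhds h0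
  rw [hc, this]; rfl

lemma TST (τ : ℍ) : T • S • T • τ = S • T⁻¹ • S • τ := by
  have h : T * S * T = -(S * T⁻¹ * S) := by decide
  simp only [← mul_smul]
  rw [← mul_assoc, h, ← mul_assoc]
  exact ModularGroup.SL_neg_smul _ _

lemma SS (τ : ℍ) : S • S • τ = τ := by
  have h : S * S = -1 := by decide
  rw [← mul_smul, h, ModularGroup.SL_neg_smul, one_smul]

lemma tendsto_im : Tendsto (fun τ : ℍ => τ.im) atImInfty atTop := tendsto_comap

lemma im_T (τ : ℍ) : (T • τ).im = τ.im := by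
  rw [modular_T_smul]; simp

lemma tendsto_T : Tendsto (fun τ : ℍ => T • τ) atImInfty atImInfty := by
  rw [atImInfty, tendsto_comap_iff]
  refine tendsto_comap.congr fun τ => ?_
  exact (im_T τ).symm

lemma vanishing {M : ℍ → ℂ} (hM : Wt 23 M)
    (hO : M =O[atImInfty] fun τ => Real.exp (-3 * Real.pi * τ.im)) : M = 0 := by
  set D := ModularForm.discriminant with hD
  have hD0 : ∀ τ, D τ ≠ 0 := ModularForm.discriminant_ne_zero
  have hDmd : MDiff D := CuspForm.discriminant.holo'
  set κ : ℍ → ℂ := fun τ => M τ ^ 24 / D τ ^ 23 with hκ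
  have hκmd : MDiff κ := by
    rw [mdifferentiable_iff] at *
    have h1 := hM.md
    rw [mdifferentiable_iff] at h1
    exact (h1.pow 24).div (hDmd.pow 23) fun z hz => pow_ne_zero _ (hD0 _)
  have hκS : ∀ τ, κ (S • τ) = κ τ := by
    intro τ
    simp only [hκ, hM.s, hD, disc_S]
    have : (J τ ^ 23 * M τ) ^ 24 = (J τ ^ 8) ^ 69 * M τ ^ 24 := by ring
    rw [this, J_eight]
    have h0 := τ.ne_zero
    have h1 := hD0 τ
    rw [hD] at h1
    field_simp
  have hκT : ∀ τ, κ (T • T • τ) = κ τ := by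
    intro τ
    simp only [hκ, hM.t2, hD, disc_T]
  have hκT' : ∀ τ, κ (T⁻¹ • τ) = κ (T • τ) := by
    intro τ
    have := hκT (T⁻¹ • τ)
    rw [smul_inv_smul] at this
    exact this.symm
  set f : ℍ → ℂ := κ * (fun τ => κ (T • τ)) * (fun τ => κ (T • S • τ)) with hf
  have m2 : MDiff (fun τ => κ (T • τ)) := md_SL T hκmd
  have m3 : MDiff (fun τ => κ (T • S • τ)) := md_SL S m2
  have hf0 : f = 0 := by
    refine eq_zero_of_SL ((hκmd.mul m2).mul m3) ?_ ?_ ?_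
    · intro τ
      simp only [hf, Pi.mul_apply, hκS, SS]
      ring
    · intro τ
      simp only [hf, Pi.mul_apply, hκT, TST, hκS, hκT']
      ring
    · have hDi : (fun τ => (D τ)⁻¹) =O[atImInfty] fun τ => Real.exp (2 * Real.pi * τ.im) := by
        have := ModularForm.exp_isBigO_discriminant.inv_rev (by simp [Real.exp_ne_zero])
        refine this.congr_right fun τ => ?_
        rw [← Real.exp_neg]; ring_nf
      have k1 : κ =O[atImInfty] fun τ => Real.exp (-26 * Real.pi * τ.im) := by
        refine ((hO.pow 24).mul (hDi.pow 23)).congr (fun τ => ?_) fun τ => ?_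
        · simp [hκ, div_eq_mul_inv]
        · rw [← Real.exp_nat_mul, ← Real.exp_nat_mul, ← Real.exp_add]
          push_cast
          ring_nf
      have k2 : (fun τ => κ (T • τ)) =O[atImInfty] fun τ => Real.exp (-26 * Real.pi * τ.im) := by
        refine (k1.comp_tendsto tendsto_T).congr (fun τ => rfl) fun τ => ?_
        simp only [Function.comp, im_T]
      have k3 : (fun τ => κ (T • S • τ)) =O[atImInfty]
          fun τ => Real.exp (46 * Real.pi * τ.im) := by
        obtain ⟨C, hC⟩ := hM.cusp.bound
        have e1 : (fun τ => κ (T • S • τ)) =O[atImInfty] fun τ => (D τ)⁻¹ ^ 23 := by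
          refine .of_bound (C ^ 24) ?_
          filter_upwards [hC] with τ hτ
          rw [norm_pow] at hτ
          simp only [hκ, hD, disc_T, disc_S]
          rw [norm_div, norm_pow, norm_pow, norm_mul, norm_pow, norm_pow, norm_inv]
          have h0 : 0 < ‖(τ : ℂ)‖ := norm_pos_iff.2 τ.ne_zero
          have h1 := norm_pos_iff.2 (hD0 τ)
          rw [hD] at h1
          have h8 : ‖J τ‖ ^ 8 = ‖(τ : ℂ)‖ ^ 4 := by rw [← norm_pow, J_eight, norm_pow]
          calc _ ≤ (C * ‖J τ‖ ^ 23) ^ 24 / (‖(τ : ℂ)‖ ^ 12 * ‖ModularForm.discriminant τ‖) ^ 23 := by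
                gcongr
            _ = C ^ 24 * (‖J τ‖ ^ 8) ^ 69 / (‖(τ : ℂ)‖ ^ 12 * ‖ModularForm.discriminant τ‖) ^ 23 := by ring
            _ = _ := by
                rw [h8]
                field_simp
        refine (e1.trans (hDi.pow 23)).congr_right fun τ => ?_
        rw [← Real.exp_nat_mul]
        push_cast
        ring_nf
      refine (((k1.mul k2).mul k3).congr_right fun τ => ?_).trans_tendsto
        (g'' := fun τ : ℍ => Real.exp (-(6 * Real.pi * τ.im))) ?_
      · rw [← Real.exp_add, ← Real.exp_add]; ring_nf
      · exact Real.tendsto_exp_neg_atTop_nhds_zero.comp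
          (tendsto_im.const_mul_atTop (by positivity))
  have hκ0 : κ = 0 := by
    rw [hf, UpperHalfPlane.mul_eq_zero_iff (hκmd.mul m2) m3,
      UpperHalfPlane.mul_eq_zero_iff hκmd m2] at hf0
    rcases hf0 with (h | h) | h
    · exact h
    · ext τ
      have := congrFun h (T⁻¹ • τ)
      simpa using this
    · ext τ
      have := congrFun h (S⁻¹ • T⁻¹ • τ)
      simpa using this
  ext τ
  have := congrFun hκ0 τ
  simpa [hκ, hD0] using this

end modular
end Elkies
end Part3

section Part4
open Complex hiding I
open Filter Asymptotics ModularGroup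
open UpperHalfPlane hiding I
open scoped Manifold MatrixGroups ModularForm Topology

namespace Elkies

section expansions

/-- half-integral nome -/
noncomputable def nome (τ : ℍ) : ℂ := cexp (Real.pi * Complex.I * τ)

lemma norm_nome (τ : ℍ) : ‖nome τ‖ = Real.exp (-Real.pi * τ.im) := by
  rw [nome, Complex.norm_exp]
  simp

/-- expansion to order two in the nome -/
def Ex (a b c : ℂ) (f : ℍ → ℂ) : Prop :=
  (fun τ => f τ - (a + b * nome τ + c * nome τ ^ 2)) =O[atImInfty] fun τ => nome τ ^ 3

lemma tendsto_nome : Tendsto nome atImInfty (𝓝 0) := by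
  rw [tendsto_zero_iff_norm_tendsto_zero]
  simp_rw [norm_nome, neg_mul]
  exact Real.tendsto_exp_neg_atTop_nhds_zero.comp (tendsto_im.const_mul_atTop Real.pi_pos)

lemma nome_O_one : nome =O[atImInfty] fun _ => (1 : ℂ) := tendsto_nome.isBigO_one ℂ

lemma Ex.one : Ex 1 0 0 1 := by
  simp only [Ex, Pi.one_apply, zero_mul, add_zero, sub_self]
  exact isBigO_zero _ _

lemma Ex.add {a b c a' b' c' : ℂ} {f g : ℍ → ℂ} (hf : Ex a b c f) (hg : Ex a' b' c' g) :
    Ex (a + a') (b + b') (c + c') (f + g) := by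
  refine (IsBigO.add hf hg).congr_left fun τ => ?_
  simp only [Pi.add_apply]
  ring

lemma Ex.smul {a b c : ℂ} {f : ℍ → ℂ} (hf : Ex a b c f) (k : ℂ) :
    Ex (k * a) (k * b) (k * c) (fun τ => k * f τ) := by
  refine (IsBigO.const_mul_left hf k).congr_left fun τ => ?_
  ring

lemma Ex.isBigO_one {a b c : ℂ} {f : ℍ → ℂ} (hf : Ex a b c f) :
    f =O[atImInfty] fun _ => (1 : ℂ) := by
  have h3 : (fun τ => nome τ ^ 3) =O[atImInfty] fun _ => (1 : ℂ) := by
    simpa using nome_O_one.pow 3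
  have h2 : (fun τ => nome τ ^ 2) =O[atImInfty] fun _ => (1 : ℂ) := by
    simpa using nome_O_one.pow 2
  have := (hf.trans h3).add (((isBigO_refl (fun _ : ℍ => (1 : ℂ)) _).const_mul_left a).add
    ((nome_O_one.const_mul_left b).add (h2.const_mul_left c)))
  refine this.congr_left fun τ => ?_
  ring

lemma Ex.mul {a b c a' b' c' : ℂ} {f g : ℍ → ℂ} (hf : Ex a b c f) (hg : Ex a' b' c' g) :
    Ex (a * a') (a * b' + b * a') (a * c' + b * b' + c * a') (f * g) := by
  have h3 : (fun τ => nome τ ^ 3) =O[atImInfty] fun τ => nome τ ^ 3 := isBigO_refl _ _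
  have hP : (fun τ => a' + b' * nome τ + c' * nome τ ^ 2) =O[atImInfty] fun _ => (1 : ℂ) := by
    apply Ex.isBigO_one (a := a') (b := b') (c := c')
    simp only [Ex, sub_self]
    exact isBigO_zero _ _
  have hP' : (fun τ => a + b * nome τ + c * nome τ ^ 2) =O[atImInfty] fun _ => (1 : ℂ) := by
    apply Ex.isBigO_one (a := a) (b := b) (c := c)
    simp only [Ex, sub_self]
    exact isBigO_zero _ _
  have e1 := IsBigO.mul hf hg.isBigO_one
  have e2 := IsBigO.mul hP' hg
  have e3 : (fun τ => nome τ ^ 3 * (b * c' + c * b' + c * c' * nome τ)) =O[atImInfty]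
      fun τ => nome τ ^ 3 * 1 := by
    refine h3.mul ?_
    exact ((isBigO_refl (fun _ : ℍ => (1 : ℂ)) _).const_mul_left (b * c' + c * b')).congr_left
      (fun _ => mul_one _) |>.add (nome_O_one.const_mul_left (c * c'))
  simp only [mul_one, one_mul] at e1 e2 e3
  refine ((e1.add e2).add e3).congr_left fun τ => ?_
  simp only [Pi.mul_apply]
  ring

lemma Ex.pow {b c : ℂ} {f : ℍ → ℂ} (hf : Ex 1 b c f) (k : ℕ) :
    Ex 1 (k * b) (k * c + k * (k - 1) / 2 * b ^ 2) (f ^ k) := by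
  induction k with
  | zero => simpa using Ex.one
  | succ k ih =>
    rw [pow_succ]
    convert ih.mul hf using 1 <;> push_cast <;> ring

lemma E4_ex : Ex 1 0 240 ModularForm.E₄ := by
  have han := ModularFormClass.analyticAt_cuspFunction_zero (h := 1) ModularForm.E₄ one_pos
    one_mem_strictPeriods_SL
  have h1 := han.hasFPowerSeriesAt.isBigO_sub_partialSum_pow 2
  have hq : Tendsto (fun τ : ℍ => Function.Periodic.qParam 1 τ) atImInfty (𝓝 0) :=
    qParam_tendsto_atImInfty one_pos
  have h2 := h1.comp_tendsto hq
  have hqn : ∀ τ : ℍ, Function.Periodic.qParam 1 τ = nome τ ^ 2 := by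
    intro τ
    rw [nome, ← Complex.exp_nat_mul, Function.Periodic.qParam]
    congr 1
    push_cast
    ring
  have c0 := EisensteinSeries.E_qExpansion_coeff_zero (k := 4) (by norm_num) ⟨2, rfl⟩
  have c1 := ModularForm.E₄_qExpansion_coeff_one
  rw [qExpansion_coeff] at c0 c1
  have h4 : (fun τ => nome τ ^ 4) =O[atImInfty] fun τ => nome τ ^ 3 := by
    have := (isBigO_refl (fun τ => nome τ ^ 3) atImInfty).mul nome_O_one
    refine this.congr (fun τ => by ring) fun τ => by ring
  refine (h2.trans (IsBigO.trans ?_ h4)).congr_left fun τ => ?_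
  · refine .of_norm_left ?_
    refine (isBigO_refl (fun τ => nome τ ^ 4) atImInfty).norm_left.congr_left fun τ => ?_
    simp only [Function.comp, hqn]
    simp [← pow_mul]
  · simp only [Function.comp, zero_add]
    rw [SlashInvariantFormClass.eq_cuspFunction ModularForm.E₄ τ one_mem_strictPeriods_SL one_ne_zero, hqn]
    congr 1
    simp [FormalMultilinearSeries.partialSum, Finset.sum_range_succ] at c0 c1 ⊢
    rw [c0, c1]
    ring

lemma E4_S (τ : ℍ) : ModularForm.E₄ (S • τ) = (τ : ℂ) ^ 4 * ModularForm.E₄ τ := by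
  have := congrFun (SlashInvariantFormClass.slash_action_eq ModularForm.E₄ (S : GL (Fin 2) ℝ)
    ⟨S, rfl⟩) τ
  rw [← ModularForm.SL_slash, ModularForm.SL_slash_apply, denom_S] at this
  have h0 := τ.ne_zero
  rw [← this, zpow_neg]
  field_simp
  
lemma E4_T (τ : ℍ) : ModularForm.E₄ (T • τ) = ModularForm.E₄ τ := by
  have := congrFun (SlashInvariantFormClass.slash_action_eq ModularForm.E₄ (T : GL (Fin 2) ℝ)
    ⟨T, rfl⟩) τ
  rw [← ModularForm.SL_slash, ModularForm.SL_slash_apply, denom_T, one_zpow, mul_one] at this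
  exact this

lemma E4_wt : Wt 8 ModularForm.E₄ where
  md := ModularForm.E₄.holo'
  t2 τ := by rw [E4_T, E4_T]
  s τ := by rw [E4_S, J_eight]
  cusp := by
    refine ((isBigO_refl (fun τ => J τ ^ 8) atImInfty).mul E4_ex.isBigO_one).congr
      (fun τ => ?_) fun τ => by ring
    rw [E4_T, E4_S, J_eight]

lemma vanishing' {M : ℍ → ℂ} (hM : Wt 23 M) (hO : Ex 0 0 0 M) : M = 0 := by
  refine vanishing hM ?_
  refine ((IsBigO.norm_right hO).congr_left fun τ => by ring).congr_right fun τ => ?_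
  rw [norm_pow, norm_nome, ← Real.exp_nat_mul]
  push_cast
  ring_nf

end expansions
end Elkies
end Part4

section Part5
open scoped RealInnerProductSpace
open Complex hiding I
open Filter Asymptotics ModularGroup
open UpperHalfPlane hiding I
open scoped Manifold MatrixGroups ModularForm Topology

namespace Elkies

section theta
variable {E : Type*} [NormedAddCommGroup E] [InnerProductSpace ℝ E] [FiniteDimensional ℝ E]

/-- theta series of a coset `u + L` -/
noncomputable def theta (L : Submodule ℤ E) (u : E) (τ : ℂ) : ℂ :=
  ∑' x : L, cexp (Real.pi * Complex.I * ((‖u + (x : E)‖ ^ 2 : ℝ) : ℂ) * τ)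

lemma norm_term (r : ℝ) (τ : ℂ) :
    ‖cexp (Real.pi * Complex.I * (r : ℂ) * τ)‖ = Real.exp (-(Real.pi * τ.im) * r) := by
  rw [Complex.norm_exp]
  congr 1
  simp [mul_re, mul_im]
  ring

lemma summable_shift (L : Submodule ℤ E) [DiscreteTopology L] (u : E) {c : ℝ} (hc : 0 < c) :
    Summable fun x : L => Real.exp (-c * ‖u + (x : E)‖ ^ 2) := by
  refine Summable.of_nonneg_of_le (fun _ => (Real.exp_pos _).le) (fun x => ?_)
    ((summable_gauss L (half_pos hc)).mul_left (Real.exp (c * ‖u‖ ^ 2)))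
  rw [← Real.exp_add]
  refine Real.exp_le_exp.2 ?_
  have h3 : ‖(x : E)‖ ≤ ‖u + x‖ + ‖u‖ := by
    have := norm_sub_le (u + (x : E)) u
    simpa using this
  have h4 : ‖(x : E)‖ ^ 2 ≤ 2 * ‖u + x‖ ^ 2 + 2 * ‖u‖ ^ 2 := by
    have := norm_nonneg (x : E)
    nlinarith [sq_nonneg (‖u + (x : E)‖ - ‖u‖)]
  nlinarith

lemma summable_theta (L : Submodule ℤ E) [DiscreteTopology L] (u : E) {τ : ℂ} (hτ : 0 < τ.im) :
    Summable fun x : L => cexp (Real.pi * Complex.I * ((‖u + (x : E)‖ ^ 2 : ℝ) : ℂ) * τ) := by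
  refine Summable.of_norm ?_
  simp_rw [norm_term]
  exact summable_shift L u (by positivity)

lemma theta_diff (L : Submodule ℤ E) [DiscreteTopology L] (u : E) :
    MDiff (fun τ : ℍ => theta L u τ) := by
  rw [mdifferentiable_iff]
  have key : DifferentiableOn ℂ (theta L u) {z | 0 < z.im} := by
    intro z hz
    have hz : 0 < z.im := hz
    have ho : IsOpen {w : ℂ | z.im / 2 < w.im} := isOpen_lt continuous_const continuous_im
    have h := differentiableOn_tsum_of_summable_norm
      (F := fun (x : L) (τ : ℂ) => cexp (Real.pi * Complex.I * ((‖u + (x : E)‖ ^ 2 : ℝ) : ℂ) * τ))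
      (u := fun x : L => Real.exp (-(Real.pi * (z.im / 2)) * ‖u + (x : E)‖ ^ 2))
      (summable_shift L u (by positivity)) (U := {w : ℂ | z.im / 2 < w.im})
      (fun x => by fun_prop) ho (fun x w hw => ?_)
    · exact (h.differentiableAt (ho.mem_nhds (by simpa using hz))).differentiableWithinAt
    · rw [norm_term]
      refine Real.exp_le_exp.2 ?_
      have hw : z.im / 2 < w.im := hw
      have := mul_le_mul_of_nonneg_right (mul_le_mul_of_nonneg_left hw.le Real.pi_pos.le)
        (sq_nonneg ‖u + (x : E)‖)
      linarith
  refine key.congr fun z hz => ?_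
  simp only [Function.comp]
  rw [ofComplex_apply_of_im_pos hz]

lemma theta_bound (L : Submodule ℤ E) [DiscreteTopology L] (u : E) :
    (fun τ : ℍ => theta L u τ) =O[atImInfty] fun _ => (1 : ℂ) := by
  refine .of_bound (∑' x : L, Real.exp (-Real.pi * ‖u + (x : E)‖ ^ 2)) ?_
  filter_upwards [tendsto_im.eventually_ge_atTop 1] with τ hτ
  rw [norm_one, mul_one]
  refine tsum_of_norm_bounded (summable_shift L u Real.pi_pos).hasSum fun x => ?_
  rw [norm_term]
  refine Real.exp_le_exp.2 ?_
  rw [neg_mul, neg_mul, neg_le_neg_iff]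
  refine mul_le_mul_of_nonneg_right ?_ (sq_nonneg _)
  exact le_mul_of_one_le_right Real.pi_pos.le hτ

/-- the points `(k+1) i` -/
noncomputable def iy (k : ℕ) : ℍ := ⟨((k + 1 : ℝ) : ℂ) * Complex.I, by simp; positivity⟩

lemma coe_iy (k : ℕ) : (iy k : ℂ) = ((k + 1 : ℝ) : ℂ) * Complex.I := rfl

lemma im_iy (k : ℕ) : (iy k).im = k + 1 := by
  rw [← UpperHalfPlane.coe_im, coe_iy]; simp

lemma tendsto_iy : Tendsto iy atTop atImInfty := by
  rw [atImInfty, tendsto_comap_iff]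
  have : UpperHalfPlane.im ∘ iy = fun k : ℕ => (k : ℝ) + 1 := by
    ext k; exact im_iy k
  rw [this]
  exact tendsto_natCast_atTop_atTop.atTop_add tendsto_const_nhds

/-- real coset theta values on the imaginary axis -/
noncomputable def phi (L : Submodule ℤ E) (u : E) (k : ℕ) : ℝ :=
  ∑' x : L, Real.exp (-(Real.pi * (k + 1)) * ‖u + (x : E)‖ ^ 2)

lemma theta_iy (L : Submodule ℤ E) (u : E) (k : ℕ) : theta L u (iy k) = (phi L u k : ℂ) := by
  rw [theta, phi, ofReal_tsum]
  refine tsum_congr fun x => ?_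
  rw [ofReal_exp, coe_iy]
  congr 1
  push_cast
  linear_combination (Real.pi * (k + 1) * (‖u + (x : E)‖ : ℂ) ^ 2) * I_sq

lemma phi_pos (L : Submodule ℤ E) [DiscreteTopology L] (u : E) (k : ℕ) : 0 < phi L u k :=
  (summable_shift L u (by positivity)).tsum_pos (fun _ => (Real.exp_pos _).le) 0 (Real.exp_pos _)

lemma phi_tendsto (L : Submodule ℤ E) [DiscreteTopology L] (u : E)
    (hu : ∀ x : L, u + (x : E) ≠ 0) : Tendsto (phi L u) atTop (𝓝 0) := by
  have := tendsto_tsum_of_dominated_convergence (𝓕 := (atTop : Filter ℕ))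
    (f := fun (k : ℕ) (x : L) => Real.exp (-(Real.pi * (k + 1)) * ‖u + (x : E)‖ ^ 2))
    (g := fun _ => (0 : ℝ)) (bound := fun x : L => Real.exp (-Real.pi * ‖u + (x : E)‖ ^ 2))
    (summable_shift L u Real.pi_pos) (fun x => ?_) (Eventually.of_forall fun k x => ?_)
  · rw [tsum_zero] at this
    exact this
  · have hx : 0 < ‖u + (x : E)‖ := norm_pos_iff.2 (hu x)
    have h1 : Tendsto (fun k : ℕ => Real.pi * ‖u + (x : E)‖ ^ 2 * ((k : ℝ) + 1)) atTop atTop :=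
      (tendsto_natCast_atTop_atTop.atTop_add tendsto_const_nhds).const_mul_atTop (by positivity)
    refine (Real.tendsto_exp_neg_atTop_nhds_zero.comp h1).congr fun k => ?_
    simp only [Function.comp]
    ring_nf
  · rw [Real.norm_of_nonneg (Real.exp_pos _).le]
    refine Real.exp_le_exp.2 ?_
    have : 0 ≤ Real.pi * k * ‖u + (x : E)‖ ^ 2 := by positivity
    linarith

lemma S_coe (τ : ℍ) : ((S • τ : ℍ) : ℂ) = -1 / τ := by
  rw [modular_S_smul]
  simp [neg_div, inv_neg]

lemma T_coe (τ : ℍ) : ((T • τ : ℍ) : ℂ) = 1 + τ := by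
  rw [modular_T_smul]
  simp

variable [MeasurableSpace E] [BorelSpace E]

lemma poisson_theta (L : Submodule ℤ E) [DiscreteTopology L] [IsZLattice ℝ L]
    (hdual : ∀ v, v ∈ L ↔ ∀ y ∈ L, ∃ k : ℤ, ⟪v, y⟫ = (k : ℝ)) (τ : ℍ) (u : E) :
    J τ ^ (Module.finrank ℝ E) * theta L u τ =
      ∑' y : L, cexp (Real.pi * Complex.I * ((‖(y : E)‖ ^ 2 : ℝ) : ℂ) * (-1 / τ)) *
        cexp (2 * Real.pi * Complex.I * (⟪(y : E), u⟫ : ℝ)) := by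
  obtain ⟨c, hc, h⟩ := poisson_lattice L hdual
  have hc1 : c = 1 := by
    have h1 := h 1 (by simp) 0
    simp only [zero_add, inner_zero_right, ofReal_zero, mul_zero, Complex.exp_zero, mul_one,
      div_one, one_cpow] at h1
    have h2 : ∑' x : L, cexp (-Real.pi * (‖(x : E)‖ : ℂ) ^ 2) =
        ((∑' x : L, Real.exp (-Real.pi * ‖(x : E)‖ ^ 2) : ℝ) : ℂ) := by
      rw [ofReal_tsum]
      refine tsum_congr fun x => ?_
      push_cast
      rfl
    have h3 : 0 < ∑' x : L, Real.exp (-Real.pi * ‖(x : E)‖ ^ 2) :=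
      (summable_gauss L Real.pi_pos).tsum_pos (fun _ => (Real.exp_pos _).le) 0 (Real.exp_pos _)
    rw [h2, ← ofReal_mul, ofReal_inj] at h1
    exact (mul_right_cancel₀ h3.ne' ((one_mul _).trans h1)).symm
  have hb : 0 < (-Complex.I * (τ : ℂ)).re := by
    simpa using τ.im_pos
  have hb0 : (-Complex.I * (τ : ℂ)) ≠ 0 := by
    intro h0
    rw [h0] at hb
    simp at hb
  have h1 := h (-Complex.I * τ) hb u
  have hl : theta L u τ = ∑' x : L, cexp (-(Real.pi * (-Complex.I * τ)) * (‖u + (x : E)‖ : ℂ) ^ 2) := by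
    refine tsum_congr fun x => ?_
    congr 1
    push_cast
    ring
  have hJ : J τ ^ (Module.finrank ℝ E) *
      (1 / (-Complex.I * (τ : ℂ))) ^ ((Module.finrank ℝ E : ℂ) / 2) = 1 := by
    rw [J, ← cpow_nat_mul, one_div (-Complex.I * (τ : ℂ)), inv_cpow _ _ ?_]
    · rw [show (Module.finrank ℝ E : ℂ) * (1 / 2) = (Module.finrank ℝ E : ℂ) / 2 by ring]
      exact mul_inv_cancel₀ (by simp [cpow_eq_zero_iff, τ.ne_zero])
    · have := Complex.abs_arg_lt_pi_div_two_iff.2 (Or.inl hb)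
      intro h0
      rw [h0, abs_of_pos Real.pi_pos] at this
      linarith [Real.pi_pos]
  rw [hl, h1, hc1, ofReal_one, one_mul, ← mul_assoc, hJ, one_mul]
  refine tsum_congr fun y => ?_
  congr 2
  have := τ.ne_zero
  push_cast
  field_simp
  linear_combination ((‖(y : E)‖ : ℂ) ^ 2) * I_sq

/-- everything needed about a theta series -/
structure ThetaData (n : ℕ) (f : ℍ → ℂ) (a b : ℕ) (φ : ℕ → ℝ) : Prop where
  wt : Wt n f
  ex : Ex 1 a b f
  pos : ∀ k, 0 < φ k
  val : ∀ k, f (T • S • iy k) = J (iy k) ^ n * (φ k : ℂ)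

lemma theta_ex (L : Submodule ℤ E) [DiscreteTopology L]
    (hintg : ∀ x : L, ∃ k : ℕ, ‖(x : E)‖ ^ 2 = (k : ℝ)) :
    Ex 1 (Nat.card {x : L | ‖(x : E)‖ ^ 2 = 1} : ℕ) (Nat.card {x : L | ‖(x : E)‖ ^ 2 = 2} : ℕ)
      (fun τ : ℍ => theta L 0 τ) := by
  have hfin : ∀ r : ℝ, {x : L | ‖(x : E)‖ ^ 2 = r}.Finite := by
    intro r
    have hs := (summable_gauss L one_pos).tendsto_cofinite_zero
    have := hs.eventually_lt_const (Real.exp_pos (-r))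
    refine Set.Finite.subset this fun x hx hx' => ?_
    have hx : ‖(x : E)‖ ^ 2 = r := hx
    have hx' : Real.exp (-1 * ‖(x : E)‖ ^ 2) < Real.exp (-r) := hx'
    rw [hx, neg_mul, one_mul] at hx'
    exact lt_irrefl _ hx'
  have hind : ∀ (r : ℝ) (z : ℂ), HasSum ({x : L | ‖(x : E)‖ ^ 2 = r}.indicator (fun _ => z))
      ((Nat.card {x : L | ‖(x : E)‖ ^ 2 = r} : ℕ) * z) := by
    intro r z
    have : Summable ({x : L | ‖(x : E)‖ ^ 2 = r}.indicator (fun _ => z)) :=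
      summable_of_hasFiniteSupport ((hfin r).subset Set.support_indicator_subset)
    convert this.hasSum using 1
    rw [← tsum_subtype, tsum_const, nsmul_eq_mul]
  have h0 : Nat.card {x : L | ‖(x : E)‖ ^ 2 = 0} = 1 := by
    have : {x : L | ‖(x : E)‖ ^ 2 = 0} = {0} := by
      ext x; simp
    rw [this]; simp
  refine .of_bound (∑' x : L, Real.exp (3 * Real.pi) * Real.exp (-Real.pi * ‖(x : E)‖ ^ 2)) ?_
  filter_upwards [tendsto_im.eventually_ge_atTop 1] with τ hτ
  have hsum := (((summable_theta L 0 τ.im_pos).hasSum.sub (hind 0 1)).sub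
    (hind 1 (nome τ))).sub (hind 2 (nome τ ^ 2))
  rw [h0] at hsum
  have he : theta L 0 τ - (1 + (Nat.card {x : L | ‖(x : E)‖ ^ 2 = 1} : ℕ) * nome τ +
      (Nat.card {x : L | ‖(x : E)‖ ^ 2 = 2} : ℕ) * nome τ ^ 2) = _ := (by
      rw [theta]; push_cast; ring : _ = _ - _ - _ - _).trans hsum.tsum_eq.symm
  rw [he, ← tsum_mul_right]
  refine tsum_of_norm_bounded
    (((summable_gauss L Real.pi_pos).mul_left _).mul_right _).hasSum fun x => ?_
  obtain ⟨k, hk⟩ := hintg x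
  have hterm : cexp (Real.pi * Complex.I * ((‖(0 : E) + (x : E)‖ ^ 2 : ℝ) : ℂ) * τ) = nome τ ^ k := by
    rw [zero_add, hk, nome, ← Complex.exp_nat_mul]
    congr 1
    push_cast
    ring
  simp only [Set.indicator, Set.mem_ofPred_eq, hk]
  rw [hterm]
  by_cases h3 : k < 3
  · have : (nome τ ^ k - (if (k : ℝ) = 0 then 1 else 0) - (if (k : ℝ) = 1 then nome τ else 0) -
        (if (k : ℝ) = 2 then nome τ ^ 2 else 0)) = 0 := by
      interval_cases k <;> simp
    rw [this, norm_zero]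
    positivity
  · push Not at h3
    have e0 : (k : ℝ) ≠ 0 := by norm_cast; omega
    have e1 : (k : ℝ) ≠ 1 := by norm_cast; omega
    have e2 : (k : ℝ) ≠ 2 := by norm_cast; omega
    rw [if_neg e0, if_neg e1, if_neg e2, sub_zero, sub_zero, sub_zero, norm_pow, norm_pow, norm_nome,
      ← Real.exp_nat_mul, ← Real.exp_nat_mul, ← Real.exp_add, ← Real.exp_add]
    refine Real.exp_le_exp.2 ?_
    have h3' : (3 : ℝ) ≤ k := by exact_mod_cast h3
    have hpi := Real.pi_pos
    have : 0 ≤ Real.pi * ((τ.im - 1) * (k - 3)) :=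
      mul_nonneg hpi.le (mul_nonneg (by linarith) (by linarith))
    push_cast
    nlinarith

lemma theta_data (L : Submodule ℤ E) [DiscreteTopology L] [IsZLattice ℝ L]
    (hdual : ∀ v, v ∈ L ↔ ∀ y ∈ L, ∃ k : ℤ, ⟪v, y⟫ = (k : ℝ))
    (w : E) (hw : ∀ y ∈ L, ∃ k : ℤ, ⟪y, y⟫ = ⟪y, w⟫ + 2 * (k : ℝ)) :
    ThetaData (Module.finrank ℝ E) (fun τ : ℍ => theta L 0 τ)
      (Nat.card {x : L | ‖(x : E)‖ ^ 2 = 1}) (Nat.card {x : L | ‖(x : E)‖ ^ 2 = 2})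
      (phi L ((1 / 2 : ℝ) • w)) := by
  have hintg : ∀ x : L, ∃ k : ℕ, ‖(x : E)‖ ^ 2 = (k : ℝ) := by
    intro x
    obtain ⟨k, hk⟩ := (hdual x).1 x.2 x x.2
    rw [real_inner_self_eq_norm_sq] at hk
    have : 0 ≤ k := by
      have := sq_nonneg ‖(x : E)‖
      rw [hk] at this
      exact_mod_cast this
    lift k to ℕ using this
    exact ⟨k, by simpa using hk⟩
  have hTS : ∀ τ : ℍ, theta L 0 (T • S • τ : ℍ) =
      J τ ^ (Module.finrank ℝ E) * theta L ((1 / 2 : ℝ) • w) τ := by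
    intro τ
    rw [poisson_theta L hdual, theta]
    refine tsum_congr fun x => ?_
    obtain ⟨k, hk⟩ := hw x x.2
    rw [← Complex.exp_add, T_coe, S_coe, inner_smul_right, zero_add]
    have : (⟪(x : E), w⟫ : ℝ) = ‖(x : E)‖ ^ 2 - 2 * k := by
      rw [← real_inner_self_eq_norm_sq, hk]; ring
    rw [this, Complex.exp_eq_exp_iff_exists_int]
    refine ⟨k, ?_⟩
    push_cast
    ring
  refine ⟨⟨theta_diff L 0, fun τ => ?_, fun τ => ?_, ?_⟩, theta_ex L hintg, phi_pos L _, fun k => ?_⟩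
  · refine tsum_congr fun x => ?_
    obtain ⟨k, hk⟩ := hintg x
    rw [zero_add, hk, T_coe, T_coe, Complex.exp_eq_exp_iff_exists_int]
    refine ⟨k, ?_⟩
    push_cast
    ring
  · beta_reduce
    rw [poisson_theta L hdual, theta]
    refine tsum_congr fun x => ?_
    rw [S_coe]
    simp
  · simp_rw [hTS]
    simpa using (isBigO_refl (fun τ => J τ ^ (Module.finrank ℝ E)) atImInfty).mul
      (theta_bound L ((1 / 2 : ℝ) • w))
  · beta_reduce
    rw [hTS, theta_iy]

end theta
end Elkies
end Part5

section Part6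
open scoped RealInnerProductSpace
open Complex hiding I
open Filter Asymptotics ModularGroup
open UpperHalfPlane hiding I
open scoped Manifold MatrixGroups ModularForm Topology

namespace Elkies

section final

lemma finite_norm {E : Type*} [NormedAddCommGroup E] [InnerProductSpace ℝ E]
    [FiniteDimensional ℝ E] (L : Submodule ℤ E) [DiscreteTopology L] (r : ℝ) :
    {x : L | ‖(x : E)‖ ^ 2 = r}.Finite := by
  have hs := (summable_gauss L one_pos).tendsto_cofinite_zero
  have := hs.eventually_lt_const (Real.exp_pos (-r))
  refine Set.Finite.subset this fun x hx hx' => ?_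
  have hx : ‖(x : E)‖ ^ 2 = r := hx
  have hx' : Real.exp (-1 * ‖(x : E)‖ ^ 2) < Real.exp (-r) := hx'
  rw [hx, neg_mul, one_mul] at hx'
  exact lt_irrefl _ hx'

lemma exists_char {E : Type*} [NormedAddCommGroup E] [InnerProductSpace ℝ E]
    [FiniteDimensional ℝ E] [MeasurableSpace E] [BorelSpace E] (L : Submodule ℤ E) [DiscreteTopology L] [IsZLattice ℝ L]
    (hdual : ∀ v, v ∈ L ↔ ∀ y ∈ L, ∃ k : ℤ, ⟪v, y⟫ = (k : ℝ)) :
    ∃ w : E, ∀ y ∈ L, ∃ k : ℤ, ⟪y, y⟫ = ⟪y, w⟫ + 2 * (k : ℝ) := by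
  classical
  let ι := Module.Free.ChooseBasisIndex ℤ L
  let β : Module.Basis ι ℤ L := Module.Free.chooseBasis ℤ L
  let bR : Module.Basis ι ℝ E := β.ofZLatticeBasis ℝ L
  have hb : ∀ i, bR i = (β i : E) := fun i => β.ofZLatticeBasis_apply ℝ L i
  obtain ⟨e, he⟩ := exists_dual_equiv L β bR hb hdual
  have hk : ∀ i, ∃ k : ℤ, ⟪(β i : E), (β i : E)⟫ = (k : ℝ) := fun i =>
    (hdual _).1 (β i).2 _ (β i).2
  choose k hk using hk
  have hw : ∀ i, ⟪(β i : E), (e k : E)⟫ = (k i : ℝ) := by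
    intro i
    have := he k (Pi.single i 1)
    rw [real_inner_comm, ← hb]
    simpa [Pi.single_apply] using this
  refine ⟨e k, fun y hy => ?_⟩
  have key : ∀ x : L, ∃ k' : ℤ, ⟪(x : E), (x : E)⟫ = ⟪(x : E), (e k : E)⟫ + 2 * (k' : ℝ) := by
    intro x
    have hx : x ∈ Submodule.span ℤ (Set.range β) := by rw [β.span_eq]; trivial
    induction hx using Submodule.span_induction with
    | mem x h =>
      obtain ⟨i, rfl⟩ := h
      exact ⟨0, by rw [hw, hk]; simp⟩
    | zero => exact ⟨0, by simp⟩
    | add x y _ _ hx hy =>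
      obtain ⟨a, ha⟩ := hx
      obtain ⟨b, hb⟩ := hy
      obtain ⟨c, hc⟩ := (hdual _).1 x.2 _ y.2
      refine ⟨a + b + c, ?_⟩
      simp only [Submodule.coe_add, inner_add_left, inner_add_right]
      rw [real_inner_comm (x : E) (y : E), ha, hb, hc]
      push_cast
      ring
    | smul a x _ hx =>
      obtain ⟨b, hb⟩ := hx
      obtain ⟨c, hc⟩ := (hdual _).1 x.2 _ (e k).2
      obtain ⟨d, hd⟩ := Int.even_mul_pred_self a
      refine ⟨a ^ 2 * b + d * c, ?_⟩
      have hd' : (a : ℝ) * (a - 1) = d + d := by exact_mod_cast hd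
      have hs : ((a • x : L) : E) = (a : ℝ) • (x : E) := by
        rw [Submodule.coe_smul, Int.cast_smul_eq_zsmul]
      rw [hs]
      simp only [inner_smul_left, inner_smul_right, conj_trivial]
      rw [hb, hc]
      push_cast
      linear_combination (c : ℝ) * hd'
  exact key ⟨y, hy⟩

lemma exists_theta3 : ∃ (g : ℍ → ℂ) (ψ : ℕ → ℝ), ThetaData 1 g 2 0 ψ ∧ Tendsto ψ atTop (𝓝 0) := by
  let b : Module.Basis Unit ℝ ℝ := Module.Basis.singleton Unit ℝ
  let L : Submodule ℤ ℝ := Submodule.span ℤ (Set.range b)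
  have hmem : ∀ x : ℝ, x ∈ L ↔ ∃ k : ℤ, x = k := by
    intro x
    have : Set.range b = {1} := by
      ext; simp [b, eq_comm]
    simp only [L, this, Submodule.mem_span_singleton]
    simp [eq_comm]
  have hinner : ∀ x y : ℝ, ⟪x, y⟫ = x * y := by
    intro x y
    simp [mul_comm]
  have hdual : ∀ v, v ∈ L ↔ ∀ y ∈ L, ∃ k : ℤ, ⟪v, y⟫ = (k : ℝ) := by
    intro v
    constructor
    · intro hv y hy
      obtain ⟨a, rfl⟩ := (hmem _).1 hv
      obtain ⟨c, rfl⟩ := (hmem _).1 hy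
      exact ⟨a * c, by rw [hinner]; push_cast; ring⟩
    · intro h
      obtain ⟨k, hk⟩ := h 1 ((hmem _).2 ⟨1, by simp⟩)
      rw [hinner, mul_one] at hk
      exact (hmem _).2 ⟨k, hk⟩
  have hw : ∀ y ∈ L, ∃ k : ℤ, ⟪y, y⟫ = ⟪y, (1 : ℝ)⟫ + 2 * (k : ℝ) := by
    intro y hy
    obtain ⟨a, rfl⟩ := (hmem _).1 hy
    obtain ⟨d, hd⟩ := Int.even_mul_pred_self a
    refine ⟨d, ?_⟩
    have hd' : (a : ℝ) * (a - 1) = d + d := by exact_mod_cast hd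
    rw [hinner, hinner]
    linear_combination hd'
  have h := theta_data L hdual 1 hw
  have hc1 : Nat.card {x : L | ‖(x : ℝ)‖ ^ 2 = 1} = 2 := by
    have : {x : L | ‖(x : ℝ)‖ ^ 2 = 1} =
        {⟨1, (hmem _).2 ⟨1, by simp⟩⟩, ⟨-1, (hmem _).2 ⟨-1, by simp⟩⟩} := by
      ext ⟨x, hx⟩
      simp
    rw [this, Nat.card_coe_set_eq, Set.ncard_pair]
    intro h0
    have := congrArg Subtype.val h0
    norm_num at this
  have hc2 : Nat.card {x : L | ‖(x : ℝ)‖ ^ 2 = 2} = 0 := by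
    have : {x : L | ‖(x : ℝ)‖ ^ 2 = 2} = ∅ := by
      ext ⟨x, hx⟩
      obtain ⟨a, rfl⟩ := (hmem _).1 hx
      simp only [Set.mem_ofPred_eq, Set.mem_empty_iff_false, iff_false, Real.norm_eq_abs, sq_abs]
      intro h2
      have h2 : a ^ 2 = 2 := by exact_mod_cast h2
      have : a < 2 := by nlinarith
      have : -2 < a := by nlinarith
      interval_cases a <;> simp at h2
    rw [this]; simp
  rw [hc1, hc2, Module.finrank_self] at h
  refine ⟨_, _, h, phi_tendsto L _ fun x => ?_⟩
  obtain ⟨a, ha⟩ := (hmem _).1 x.2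
  rw [ha, smul_eq_mul, mul_one]
  intro h0
  have : (1 + 2 * a : ℤ) = 0 := by
    have : (1 : ℝ) + 2 * a = 0 := by linarith
    exact_mod_cast this
  omega

lemma E4_tendsto : Tendsto (ModularForm.E₄ : ℍ → ℂ) atImInfty (𝓝 1) := by
  have h3 : Tendsto (fun τ => nome τ ^ 3) atImInfty (𝓝 0) := by
    simpa using tendsto_nome.pow 3
  have h1 := IsBigO.trans_tendsto E4_ex h3
  have h2 : Tendsto (fun τ => 1 + 0 * nome τ + 240 * nome τ ^ 2) atImInfty (𝓝 1) := by
    have := (tendsto_nome.pow 2).const_mul (240 : ℂ) |>.const_add 1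
    simpa using this
  have := h1.add h2
  simpa using this

lemma main_ineq {n N : ℕ} (hn : n ≤ 23) {f : ℍ → ℂ} {φ : ℕ → ℝ} (hf : ThetaData n f 0 N φ) :
    2 * (n : ℝ) * (23 - n) ≤ N := by
  obtain ⟨g, ψ, hg, hψ⟩ := exists_theta3
  obtain ⟨m, hm⟩ : ∃ m, n + m = 23 := ⟨23 - n, by omega⟩
  have hmC : (n : ℂ) + m = 23 := by exact_mod_cast hm
  have hmR : (n : ℝ) + m = 23 := by exact_mod_cast hm
  obtain ⟨A2, hA2⟩ : ∃ A2 : ℝ, A2 = N + 2 * m * (m - 1) := ⟨_, rfl⟩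
  obtain ⟨β, hβ⟩ : ∃ β : ℂ, β = (368 - A2 + 28 * m) / 128 := ⟨_, rfl⟩
  obtain ⟨α, hα⟩ : ∃ α : ℂ, α = (2 * m - 14 - 16 * β) / 32 := ⟨_, rfl⟩
  obtain ⟨γ, hγ⟩ : ∃ γ : ℝ, γ = (A2 - 44 * m) / 256 := ⟨_, rfl⟩
  have w1 : Wt 23 (f * g ^ m) := by
    have := hf.wt.mul (hg.wt.pow m)
    rwa [one_mul, hm] at this
  have w2 : Wt 23 (g ^ 7 * ((fun τ => α * (g ^ 16) τ) +
      (fun τ => β * (g ^ 8 * (ModularForm.E₄ : ℍ → ℂ)) τ) +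
      (fun τ => (γ : ℂ) * ((ModularForm.E₄ : ℍ → ℂ) ^ 2) τ))) :=
    (hg.wt.pow 7).mul ((((hg.wt.pow 16).smul α).add (((hg.wt.pow 8).mul E4_wt).smul β)).add
      ((E4_wt.pow 2).smul γ))
  have x1 := hf.ex.mul (hg.ex.pow m)
  have x2 := (hg.ex.pow 7).mul ((((hg.ex.pow 16).smul α).add (((hg.ex.pow 8).mul E4_ex).smul β)).add
      ((E4_ex.pow 2).smul γ))
  have hM := vanishing' (w1.add (w2.smul (-1))) (by
    convert x1.add (x2.smul (-1)) using 1
    · push_cast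
      rw [hγ, hα, hβ, hA2]
      push_cast
      ring
    · push_cast
      rw [hγ, hα, hβ, hA2]
      push_cast
      ring
    · push_cast
      rw [hγ, hα, hβ, hA2]
      push_cast
      ring)
  have hval : ∀ k, (((φ k * ψ k ^ m / ψ k ^ 7 : ℝ)) : ℂ) = α * (ψ k : ℂ) ^ 16 +
      β * (ψ k : ℂ) ^ 8 * ModularForm.E₄ (iy k) + γ * ModularForm.E₄ (iy k) ^ 2 := by
    intro k
    have h0 := congrFun hM (T • S • iy k)
    simp only [Pi.add_apply, Pi.mul_apply, Pi.pow_apply, Pi.zero_apply, hf.val, hg.val, E4_T,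
      E4_S, ← J_eight] at h0
    have hJ := J_ne_zero (iy k)
    have hψ0 : (ψ k : ℂ) ≠ 0 := by exact_mod_cast (hg.pos k).ne'
    have e1 : J (iy k) ^ n * J (iy k) ^ m = J (iy k) ^ 23 := by rw [← pow_add, hm]
    have h1 : J (iy k) ^ 23 * ((φ k : ℂ) * (ψ k : ℂ) ^ m) = J (iy k) ^ 23 * ((ψ k : ℂ) ^ 7 *
        (α * (ψ k : ℂ) ^ 16 + β * (ψ k : ℂ) ^ 8 * ModularForm.E₄ (iy k) +
          γ * ModularForm.E₄ (iy k) ^ 2)) := by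
      rw [← e1]
      rw [mul_pow _ _ m] at h0
      rw [e1]
      linear_combination h0 - (φ k : ℂ) * (ψ k : ℂ) ^ m * e1
    have h2 := mul_left_cancel₀ (pow_ne_zero 23 hJ) h1
    push_cast
    rw [h2]
    field_simp
  have hE : Tendsto (fun k => ModularForm.E₄ (iy k)) atTop (𝓝 1) := E4_tendsto.comp tendsto_iy
  have hψC : Tendsto (fun k => (ψ k : ℂ)) atTop (𝓝 0) := by
    have := (continuous_ofReal.tendsto 0).comp hψ
    rw [ofReal_zero] at this
    exact this
  have hlim : Tendsto (fun k => (((φ k * ψ k ^ m / ψ k ^ 7 : ℝ)) : ℂ)) atTop (𝓝 (γ : ℂ)) := by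
    simp_rw [hval]
    have := (((hψC.pow 16).const_mul α).add (((hψC.pow 8).const_mul β).mul hE)).add
      ((hE.pow 2).const_mul (γ : ℂ))
    simpa using this
  have hlim' : Tendsto (fun k => φ k * ψ k ^ m / ψ k ^ 7) atTop (𝓝 γ) := by
    have := (Complex.continuous_re.tendsto _).comp hlim
    rw [ofReal_re] at this
    exact this
  have hγ0 : 0 ≤ γ := ge_of_tendsto' hlim' fun k => by
    have := hf.pos k
    have := hg.pos k
    positivity
  rw [hγ, hA2] at hγ0
  have hn' : (n : ℝ) = 23 - m := by linarith
  rw [hn']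
  linarith

end final
end Elkies

end Part6

open Elkies
/-- A unimodular lattice in `ℝⁿ` with no vectors of norm 1 has finitely many vectors of
norm 2, and at least `2n(23 − n)` of them. -/
theorem card_norm_two_ge (n : ℕ) (L : Submodule ℤ (EuclideanSpace ℝ (Fin n)))
    (hL : IsUnimodularLattice n L)
    (h1 : ∀ x ∈ L, ⟪x, x⟫ ≠ (1 : ℝ)) :
    {x : EuclideanSpace ℝ (Fin n) | x ∈ L ∧ ⟪x, x⟫ = (2 : ℝ)}.Finite ∧
    2 * (n : ℤ) * (23 - (n : ℤ)) ≤
      ({x : EuclideanSpace ℝ (Fin n) | x ∈ L ∧ ⟪x, x⟫ = (2 : ℝ)}.ncard : ℤ) := by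
  obtain ⟨hd, hspan, hdual⟩ := hL
  have : DiscreteTopology L := hd
  have : IsZLattice ℝ L := ⟨hspan⟩
  have himg : {x : EuclideanSpace ℝ (Fin n) | x ∈ L ∧ ⟪x, x⟫ = (2 : ℝ)} =
      Subtype.val '' {x : L | ‖(x : EuclideanSpace ℝ (Fin n))‖ ^ 2 = 2} := by
    ext x
    simp only [Set.mem_ofPred_eq, Set.mem_image, Subtype.exists, exists_and_left, exists_prop,
      exists_eq_right_right, real_inner_self_eq_norm_sq]
    exact and_comm
  rw [himg]
  refine ⟨(finite_norm L 2).image _, ?_⟩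
  rw [Set.ncard_image_of_injective _ Subtype.val_injective]
  by_cases hn : n ≤ 23
  · obtain ⟨w, hw⟩ := exists_char L hdual
    have hf := theta_data L hdual w hw
    have hc1 : Nat.card {x : L | ‖(x : EuclideanSpace ℝ (Fin n))‖ ^ 2 = 1} = 0 := by
      have : {x : L | ‖(x : EuclideanSpace ℝ (Fin n))‖ ^ 2 = 1} = ∅ := by
        ext x
        simp only [Set.mem_ofPred_eq, Set.mem_empty_iff_false, iff_false]
        rw [← real_inner_self_eq_norm_sq]
        exact h1 x x.2
      rw [this]; simp
    rw [hc1, finrank_euclideanSpace_fin] at hf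
    have := main_ineq hn hf
    rw [Nat.card_coe_set_eq] at this
    exact_mod_cast this
  · have h2 : 2 * (n : ℤ) * (23 - (n : ℤ)) ≤ 0 :=
      mul_nonpos_of_nonneg_of_nonpos (by positivity) (by omega)
    exact h2.trans (by positivity)
end

section
/- Let L be a unimodular lattice in ℝ^n having no vectors of norm 1, and let N₂ be the (finite) number of vectors x ∈ L with ⟪x,x⟫ = 2. Then N₂ = 2n(23 − n) if and only if every characteristic vector w of L has norm ⟪w,w⟫ ≥ n − 8. -/
open scoped RealInnerProductSpace

namespace LS

noncomputable section

open ModularGroup MatrixGroups Filter Topology Asymptotics Complex Manifold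
open UpperHalfPlane hiding I
open scoped ModularForm Real
/-- A level one weight zero holomorphic function which is bounded at infinity is constant. -/
lemma const_of_invariant (F : ℍ → ℂ) (hol : MDiff F)
    (hT : ∀ τ, F (T • τ) = F τ) (hS : ∀ τ, F (S • τ) = F τ) (hb : IsBoundedAtImInfty F) :
    ∃ c, ∀ τ, F τ = c := by
  have hinv : ∀ γ : SL(2, ℤ), F ∣[(0 : ℤ)] γ = F := by
    apply SlashInvariantForm.slash_action_generators_SL2Z
    · ext τ
      rw [ModularForm.SL_slash_apply, hS]
      simp
    · ext τ
      rw [ModularForm.SL_slash_apply, hT]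
      simp
  let f : ModularForm 𝒮ℒ 0 :=
    { toFun := F
      slash_action_eq' := fun _ ⟨γ, hγ⟩ ↦ hγ ▸ hinv γ
      holo' := hol
      bdd_at_cusps' := by
        intro c hc
        rw [Subgroup.IsArithmetic.isCusp_iff_isCusp_SL2Z] at hc
        rw [OnePoint.isBoundedAt_iff_forall_SL2Z hc]
        intro γ _
        rw [hinv γ]
        exact hb }
  obtain ⟨c, hc⟩ := ModularFormClass.levelOne_weight_zero_const f
  exact ⟨c, fun τ => congrFun hc τ⟩

lemma coe_S (τ : ℍ) : ((S • τ : ℍ) : ℂ) = -1 / (τ : ℂ) := by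
  rw [UpperHalfPlane.modular_S_smul]
  simp [div_eq_mul_inv]

lemma coe_T (τ : ℍ) : ((T • τ : ℍ) : ℂ) = (τ : ℂ) + 1 := by
  rw [UpperHalfPlane.modular_T_smul]
  simp [add_comm]

lemma SS (τ : ℍ) : (S • S • τ : ℍ) = τ := by
  ext
  rw [coe_S, coe_S]
  have := τ.ne_zero
  field_simp

lemma TSTST (τ : ℍ) : (T • S • T • S • T • τ : ℍ) = S • τ := by
  ext
  simp only [coe_S, coe_T]
  have h0 := τ.ne_zero
  have h1 : (τ : ℂ) + 1 ≠ 0 := by rw [← coe_T]; exact (T • τ).ne_zero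
  have h2 : -1 / ((τ : ℂ) + 1) + 1 = τ / (τ + 1) := by field_simp; ring
  rw [h2]
  field_simp
  ring

/-- invariance of `f(1 - 1/τ)` under translation -/
lemma inv_TST (f : ℍ → ℂ) (hT2 : ∀ τ, f (T • T • τ) = f τ) (hS : ∀ τ, f (S • τ) = f τ) (τ : ℍ) :
    f (T • S • T • τ) = f (T • S • τ) := by
  rw [← hS, ← hT2, TSTST]

lemma tendsto_T : Filter.Tendsto (fun τ : ℍ => T • τ) atImInfty atImInfty := by
  simp only [atImInfty, Filter.tendsto_comap_iff]
  have : (UpperHalfPlane.im ∘ fun τ : ℍ => T • τ) = UpperHalfPlane.im := by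
    ext τ
    have := congrArg Complex.im (coe_T τ)
    simpa using this
  rw [this]
  exact Filter.tendsto_comap

lemma mdiff_smul (f : ℍ → ℂ) (hol : MDiff f) (γ : Matrix.SpecialLinearGroup (Fin 2) ℤ) :
    MDiff (fun τ : ℍ => f (γ • τ)) := by
  have : MDiff (fun τ : ℍ => (γ : GL (Fin 2) ℝ) • τ) := UpperHalfPlane.mdifferentiable_smul (by simp)
  exact hol.comp this

lemma eventually_zero (f : ℍ → ℂ) (hol : MDiff f)
    (hT2 : ∀ τ, f (T • T • τ) = f τ) (hS : ∀ τ, f (S • τ) = f τ)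
    (h0 : Tendsto f atImInfty (𝓝 0)) (hb : IsBoundedAtImInfty (fun τ => f (T • S • τ))) :
    ∀ᶠ τ in atImInfty, f τ = 0 := by
  have h4 : Tendsto (fun τ => f (T • τ)) atImInfty (𝓝 0) := h0.comp tendsto_T
  have hol4 : MDiff (fun τ => f (T • τ)) := mdiff_smul f hol T
  have hol2 : MDiff (fun τ => f (T • S • τ)) := mdiff_smul _ hol4 S
  have b0 : IsBoundedAtImInfty f := h0.isBigO_one ℝ
  have b4 : IsBoundedAtImInfty (fun τ => f (T • τ)) := h4.isBigO_one ℝ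
  have z0 : IsZeroAtImInfty f := h0
  have z4 : IsZeroAtImInfty (fun τ => f (T • τ)) := h4
  have mulz : ∀ {u v : ℍ → ℂ}, Tendsto u atImInfty (𝓝 0) → IsBoundedAtImInfty v →
      Tendsto (fun τ => u τ * v τ) atImInfty (𝓝 0) := by
    intro u v hu hv
    have : (fun τ => u τ * v τ) =o[atImInfty] (fun τ => (1 : ℂ) * (1 : ℂ)) :=
      ((isLittleO_one_iff ℂ).2 hu).mul_isBigO
        (hv.trans (isBigO_refl _ _ |>.trans (by simpa using isBigO_const_const (1:ℝ) (one_ne_zero : (1:ℂ) ≠ 0) _)))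
    simpa using this
  have hST := inv_TST f hT2 hS
  have e1t : ∀ τ, f τ + f (T • τ) + f (T • S • τ) = f τ + f (T • τ) + f (T • S • τ) := fun _ => rfl
  obtain ⟨c1, hc1⟩ := const_of_invariant (fun τ => f τ + f (T • τ) + f (T • S • τ))
    ((hol.add hol4).add hol2) (by intro τ; simp only [hT2, hST]; ring)
    (by intro τ; simp only [hS, SS]; ring) ((b0.add b4).add hb)
  have t2 : Tendsto (fun τ => f τ * f (T • τ) + f τ * f (T • S • τ) + f (T • τ) * f (T • S • τ))
      atImInfty (𝓝 0) := by
    simpa using ((mulz h0 b4).add (mulz h0 hb)).add (mulz h4 hb)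
  obtain ⟨c2, hc2⟩ := const_of_invariant
    (fun τ => f τ * f (T • τ) + f τ * f (T • S • τ) + f (T • τ) * f (T • S • τ))
    (((hol.mul hol4).add (hol.mul hol2)).add (hol4.mul hol2))
    (by intro τ; simp only [hT2, hST]; ring)
    (by intro τ; simp only [hS, SS]; ring) (t2.isBigO_one ℝ)
  have t3 : Tendsto (fun τ => f τ * f (T • τ) * f (T • S • τ)) atImInfty (𝓝 0) := by
    simpa using mulz (mulz h0 b4) hb
  obtain ⟨c3, hc3⟩ := const_of_invariant
    (fun τ => f τ * f (T • τ) * f (T • S • τ))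
    ((hol.mul hol4).mul hol2)
    (by intro τ; simp only [hT2, hST]; ring)
    (by intro τ; simp only [hS, SS]; ring) (t3.isBigO_one ℝ)
  have hc2' : c2 = 0 := by
    simp only [hc2] at t2
    exact tendsto_nhds_unique tendsto_const_nhds t2
  have hc3' : c3 = 0 := by
    simp only [hc3] at t3
    exact tendsto_nhds_unique tendsto_const_nhds t3
  have key : ∀ τ, f τ ^ 2 * (f τ - c1) = 0 := by
    intro τ
    have a1 := hc1 τ
    have a2 := hc2 τ
    have a3 := hc3 τ
    simp only [hc2', hc3'] at a1 a2 a3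
    rw [← a1]
    linear_combination (-f τ) * a2 + a3
  by_cases h : c1 = 0
  · refine Eventually.of_forall fun τ => ?_
    have := key τ
    rw [h, sub_zero] at this
    have h3 : f τ ^ 3 = 0 := by linear_combination this
    exact pow_eq_zero_iff (by norm_num) |>.1 h3
  · filter_upwards [h0.eventually_ne (Ne.symm h)] with τ hτ
    have := key τ
    rcases mul_eq_zero.1 this with h' | h'
    · exact pow_eq_zero_iff (by norm_num) |>.1 h'
    · exact absurd (sub_eq_zero.1 h') hτ
/-- Second order expansion at `i∞` in the variable `Q`. -/
def E3 (Q f : ℍ → ℂ) (a b c : ℂ) : Prop :=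
  (fun τ => f τ - (a + b * Q τ + c * Q τ ^ 2)) =O[atImInfty] (fun τ => Q τ ^ 3)

section E3rules

variable {Q f g : ℍ → ℂ} {a b c a' b' c' : ℂ}

lemma pow_isBigO_one (hQ : Tendsto Q atImInfty (𝓝 0)) (m : ℕ) :
    (fun τ => Q τ ^ m) =O[atImInfty] (fun _ => (1 : ℂ)) := by
  have : Q =O[atImInfty] (fun _ => (1 : ℂ)) := hQ.isBigO_one ℂ
  simpa using this.pow m

lemma pow_isBigO_pow (hQ : Tendsto Q atImInfty (𝓝 0)) {m k : ℕ} (h : m ≤ k) :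
    (fun τ => Q τ ^ k) =O[atImInfty] (fun τ => Q τ ^ m) := by
  obtain ⟨j, rfl⟩ := Nat.exists_eq_add_of_le h
  have := (isBigO_refl (fun τ => Q τ ^ m) atImInfty).mul (pow_isBigO_one hQ j)
  simpa [pow_add] using this

lemma E3.congr (h : E3 Q f a b c) (hfg : ∀ τ, g τ = f τ) (ha : a' = a) (hb : b' = b) (hc : c' = c) :
    E3 Q g a' b' c' := by
  have : g = f := funext hfg
  subst this ha hb hc
  exact h

lemma E3.add (h : E3 Q f a b c) (h' : E3 Q g a' b' c') :
    E3 Q (fun τ => f τ + g τ) (a + a') (b + b') (c + c') := by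
  have := IsBigO.add h h'
  refine this.congr_left fun τ => ?_
  ring

lemma E3.const (x : ℂ) : E3 Q (fun _ => x) x 0 0 := by
  unfold E3
  simpa using isBigO_zero _ _

lemma E3.self : E3 Q Q 0 1 0 := by
  unfold E3
  simpa using isBigO_zero _ _

lemma E3.isBigO_one (hQ : Tendsto Q atImInfty (𝓝 0)) (h : E3 Q f a b c) :
    f =O[atImInfty] (fun _ => (1 : ℂ)) := by
  have h1 := IsBigO.trans h (pow_isBigO_one hQ 3)
  have h2 : (fun τ => a + b * Q τ + c * Q τ ^ 2) =O[atImInfty] (fun _ => (1 : ℂ)) := by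
    refine ((isBigO_const_const a one_ne_zero _).add ?_).add ?_
    · simpa using ((pow_isBigO_one hQ 1).const_mul_left b)
    · simpa using ((pow_isBigO_one hQ 2).const_mul_left c)
  refine (h1.add h2).congr_left fun τ => ?_
  ring

lemma E3.tendsto (hQ : Tendsto Q atImInfty (𝓝 0)) (h : E3 Q f a b c) :
    Tendsto f atImInfty (𝓝 a) := by
  have h1 : Tendsto (fun τ => f τ - (a + b * Q τ + c * Q τ ^ 2)) atImInfty (𝓝 0) := by
    refine IsBigO.trans_tendsto h ?_
    simpa using hQ.pow 3
  have h2 : Tendsto (fun τ => a + b * Q τ + c * Q τ ^ 2) atImInfty (𝓝 a) := by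
    have := ((tendsto_const_nhds (x := a) (f := atImInfty)).add (hQ.const_mul b)).add
      ((hQ.pow 2).const_mul c)
    simpa using this
  simpa using h1.add h2

lemma E3.mul (hQ : Tendsto Q atImInfty (𝓝 0)) (h : E3 Q f a b c) (h' : E3 Q g a' b' c') :
    E3 Q (fun τ => f τ * g τ) (a * a') (a * b' + b * a') (a * c' + b * b' + c * a') := by
  have h1 : (fun τ => (f τ - (a + b * Q τ + c * Q τ ^ 2)) * g τ)
      =O[atImInfty] (fun τ => Q τ ^ 3) := by
    simpa using IsBigO.mul h (h'.isBigO_one hQ)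
  have hp : (fun τ => a + b * Q τ + c * Q τ ^ 2) =O[atImInfty] (fun _ => (1 : ℂ)) := by
    refine ((isBigO_const_const a one_ne_zero _).add ?_).add ?_
    · simpa using ((pow_isBigO_one hQ 1).const_mul_left b)
    · simpa using ((pow_isBigO_one hQ 2).const_mul_left c)
  have h2 : (fun τ => (a + b * Q τ + c * Q τ ^ 2) * (g τ - (a' + b' * Q τ + c' * Q τ ^ 2)))
      =O[atImInfty] (fun τ => Q τ ^ 3) := by
    simpa using IsBigO.mul hp h'
  have h3 : (fun τ => (b * c' + c * b') * Q τ ^ 3) =O[atImInfty] (fun τ => Q τ ^ 3) :=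
    (isBigO_refl _ _).const_mul_left _
  have h4 : (fun τ => (c * c') * Q τ ^ 4) =O[atImInfty] (fun τ => Q τ ^ 3) :=
    (pow_isBigO_pow hQ (by norm_num)).const_mul_left _
  refine (((h1.add h2).add h3).add h4).congr_left fun τ => ?_
  ring

lemma E3.const_mul (hQ : Tendsto Q atImInfty (𝓝 0)) (h : E3 Q f a b c) (x : ℂ) :
    E3 Q (fun τ => x * f τ) (x * a) (x * b) (x * c) :=
  ((E3.const x).mul hQ h).congr (fun _ => rfl) rfl (by ring) (by ring)

lemma E3.pow (hQ : Tendsto Q atImInfty (𝓝 0)) (h : E3 Q f 1 b c) (m : ℕ) :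
    E3 Q (fun τ => f τ ^ m) 1 (m * b) (m * c + m * (m - 1) / 2 * b ^ 2) := by
  induction m with
  | zero => exact (E3.const 1).congr (by simp) rfl (by simp) (by simp)
  | succ m ih =>
    refine (ih.mul hQ h).congr (fun τ => pow_succ _ _) (by ring) (by push_cast; ring) ?_
    push_cast
    ring

lemma E3.unique (hQ : Tendsto Q atImInfty (𝓝 0)) (hQ0 : ∀ τ, Q τ ≠ 0)
    (h : E3 Q f a b c) (h' : E3 Q f a' b' c') : a = a' ∧ b = b' ∧ c = c' := by
  have ha : a = a' := tendsto_nhds_unique (h.tendsto hQ) (h'.tendsto hQ)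
  subst ha
  have h1 : (fun τ => (b' - b) * Q τ + (c' - c) * Q τ ^ 2) =O[atImInfty] (fun τ => Q τ ^ 3) := by
    refine (IsBigO.sub h h').congr_left fun τ => ?_
    ring
  have h2 : (fun τ => (b' - b) + (c' - c) * Q τ) =O[atImInfty] (fun τ => Q τ ^ 2) := by
    have := h1.mul (isBigO_refl (fun τ => (Q τ)⁻¹) atImInfty)
    refine this.congr (fun τ => ?_) (fun τ => ?_)
    · have := hQ0 τ
      field_simp
    · have := hQ0 τ
      field_simp
  have h3 : Tendsto (fun τ => (b' - b) + (c' - c) * Q τ) atImInfty (𝓝 0) :=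
    h2.trans_tendsto (by simpa using hQ.pow 2)
  have h4 : Tendsto (fun τ => (b' - b) + (c' - c) * Q τ) atImInfty (𝓝 (b' - b)) := by
    simpa using (hQ.const_mul (c' - c)).const_add (b' - b)
  have hb : b' - b = 0 := tendsto_nhds_unique h4 h3
  rw [hb] at h2
  have h5 : (fun τ => (c' - c)) =O[atImInfty] (fun τ => Q τ) := by
    have := h2.mul (isBigO_refl (fun τ => (Q τ)⁻¹) atImInfty)
    refine this.congr (fun τ => ?_) (fun τ => ?_)
    · have := hQ0 τ
      field_simp
      ring
    · have := hQ0 τ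
      field_simp
  have h6 : Tendsto (fun _ : ℍ => (c' - c)) atImInfty (𝓝 0) := h5.trans_tendsto hQ
  have hc : c' - c = 0 := tendsto_nhds_unique tendsto_const_nhds h6
  exact ⟨rfl, (sub_eq_zero.1 hb).symm, (sub_eq_zero.1 hc).symm⟩

end E3rules

lemma finite_fiber {ι : Type*} (k : ι → ℕ) (r : ℝ) (hr : 0 < r)
    (hs : Summable (fun i => r ^ k i)) (j : ℕ) : {i | k i = j}.Finite := by
  have h := hs.tendsto_cofinite_zero.eventually_ne (show (0 : ℝ) ≠ r ^ j from (pow_pos hr j).ne)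
  rw [Filter.eventually_cofinite] at h
  refine h.subset fun i hi => ?_
  have : k i = j := hi
  simp [this]

lemma hasSum_fiber {ι : Type*} (k : ι → ℕ) (j : ℕ) (hf : {i | k i = j}.Finite) (x : ℂ) :
    HasSum (fun i => if k i = j then x else 0) (({i | k i = j}.ncard : ℂ) * x) := by
  have h := hasSum_sum_of_ne_finset_zero (L := .unconditional ι) (f := fun i => if k i = j then x else 0)
    (s := hf.toFinset) (by intro i hi; simp at hi; simp [hi])
  convert h using 1
  rw [Finset.sum_congr rfl (g := fun _ => x) (by intro i hi; simp at hi; simp [hi])]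
  rw [Finset.sum_const, Set.ncard_eq_toFinset_card _ hf, nsmul_eq_mul]

lemma expansion {ι : Type*} (Q : ℍ → ℂ) (hQ : Tendsto Q atImInfty (𝓝 0)) (k : ι → ℕ) (r : ℝ)
    (hr : 0 < r) (hs : Summable (fun i => r ^ k i)) :
    E3 Q (fun τ => ∑' i, Q τ ^ k i) ({i | k i = 0}.ncard) ({i | k i = 1}.ncard)
      ({i | k i = 2}.ncard) := by
  have hev : ∀ᶠ τ in atImInfty, ‖Q τ‖ < r := by
    have : Tendsto (fun τ => ‖Q τ‖) atImInfty (𝓝 0) := by simpa using hQ.norm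
    exact this.eventually_lt_const hr
  have hB : Summable (fun i => if 3 ≤ k i then r ^ (k i - 3) else 0) := by
    refine Summable.of_nonneg_of_le (fun i => ?_) (fun i => ?_) (hs.mul_left (r ^ 3)⁻¹)
    · split_ifs <;> positivity
    · split_ifs with h
      · obtain ⟨j, hj⟩ := Nat.exists_eq_add_of_le h
        rw [hj, Nat.add_sub_cancel_left, pow_add]
        field_simp
        exact le_rfl
      · positivity
  refine IsBigO.of_bound (∑' i, if 3 ≤ k i then r ^ (k i - 3) else 0) ?_
  filter_upwards [hev] with τ hτ
  set x := Q τ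
  have hle : ∀ i, ‖(if 3 ≤ k i then x ^ k i else 0)‖ ≤
      ‖x ^ 3‖ * (if 3 ≤ k i then r ^ (k i - 3) else 0) := by
    intro i
    split_ifs with h
    · obtain ⟨j, hj⟩ := Nat.exists_eq_add_of_le h
      rw [hj, Nat.add_sub_cancel_left, pow_add, norm_mul, norm_pow x j]
      gcongr
    · simp
  have hsum3 : Summable (fun i => if 3 ≤ k i then x ^ k i else 0) :=
    Summable.of_norm_bounded (hB.mul_left _) hle
  have hfin := finite_fiber k r hr hs
  have H := (((hasSum_fiber k 0 (hfin 0) 1).add (hasSum_fiber k 1 (hfin 1) x)).add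
    (hasSum_fiber k 2 (hfin 2) (x ^ 2))).add hsum3.hasSum
  have H' : HasSum (fun i => x ^ k i) (({i | k i = 0}.ncard : ℂ) * 1 + ({i | k i = 1}.ncard : ℂ) * x
      + ({i | k i = 2}.ncard : ℂ) * x ^ 2 + ∑' i, if 3 ≤ k i then x ^ k i else 0) := by
    refine H.congr_fun fun i => ?_
    rcases h : k i with _ | _ | _ | m
    · simp
    · simp
    · simp
    · simp
  rw [H'.tsum_eq]
  have : ({i | k i = 0}.ncard : ℂ) * 1 + ({i | k i = 1}.ncard : ℂ) * x
      + ({i | k i = 2}.ncard : ℂ) * x ^ 2 + (∑' i, if 3 ≤ k i then x ^ k i else 0)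
      - (({i | k i = 0}.ncard : ℂ) + ({i | k i = 1}.ncard : ℂ) * x
      + ({i | k i = 2}.ncard : ℂ) * x ^ 2) = ∑' i, if 3 ≤ k i then x ^ k i else 0 := by ring
  rw [this]
  refine (tsum_of_norm_bounded (hB.hasSum.mul_left _) hle).trans (le_of_eq (mul_comm _ _))

/-- The third Jacobi theta constant. -/
def t3 (τ : ℍ) : ℂ := jacobiTheta₂ 0 τ
/-- The fourth Jacobi theta constant. -/
def t4 (τ : ℍ) : ℂ := jacobiTheta₂ (1 / 2) τ
/-- The second Jacobi theta constant. -/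
def t2 (τ : ℍ) : ℂ := cexp (π * I * τ / 4) * jacobiTheta₂ (τ / 2) τ
/-- The automorphy factor. -/
def K (τ : ℍ) : ℂ := 1 / (-I * τ) ^ (1 / 2 : ℂ)
/-- The nome. -/
def Q (τ : ℍ) : ℂ := cexp (π * I * τ)

lemma negI_ne (τ : ℍ) : (-I * (τ : ℂ)) ≠ 0 := mul_ne_zero (by simp) τ.ne_zero

lemma K_ne (τ : ℍ) : K τ ≠ 0 := by
  unfold K
  have : (-I * (τ : ℂ)) ^ (1 / 2 : ℂ) ≠ 0 := by
    rw [Complex.cpow_ne_zero_iff]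
    left
    exact negI_ne τ
  simpa using this

lemma K_sq (τ : ℍ) : K τ ^ 2 = 1 / (-I * τ) := by
  unfold K
  rw [div_pow, one_pow, ← Complex.cpow_nat_mul]
  norm_num

lemma K_pow24 (τ : ℍ) : K τ ^ 24 = 1 / (τ : ℂ) ^ 12 := by
  have : K τ ^ 24 = (K τ ^ 2) ^ 12 := by ring
  rw [this, K_sq, div_pow, mul_pow, neg_pow, show I ^ 12 = (I ^ 4) ^ 3 by ring, I_pow_four]
  norm_num

lemma t3_S (τ : ℍ) : t3 (S • τ) = t3 τ / K τ := by
  rw [eq_div_iff (K_ne τ)]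
  unfold t3
  rw [coe_S]
  conv_rhs => rw [jacobiTheta₂_functional_equation]
  simp [K, mul_comm]

lemma t4_S (τ : ℍ) : t4 (S • τ) = t2 τ / K τ := by
  rw [eq_div_iff (K_ne τ)]
  unfold t4 t2
  rw [coe_S]
  conv_rhs => rw [jacobiTheta₂_functional_equation]
  have h0 := τ.ne_zero
  have h1 : (τ : ℂ) / 2 / τ = 1 / 2 := by field_simp
  have h2 : cexp (π * I * τ / 4) * cexp (-π * I * (τ / 2) ^ 2 / τ) = 1 := by
    rw [← Complex.exp_add, ← Complex.exp_zero]
    congr 1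
    field_simp
    ring
  rw [h1, K]
  linear_combination (-(1 / (-I * (τ : ℂ)) ^ (1 / 2 : ℂ)) * jacobiTheta₂ (1 / 2) (-1 / τ)) * h2

lemma t2_S (τ : ℍ) : t2 (S • τ) = t4 τ / K τ := by
  rw [eq_div_iff (K_ne τ)]
  unfold t4 t2
  rw [coe_S]
  conv_rhs => rw [jacobiTheta₂_functional_equation]
  have h0 := τ.ne_zero
  have h1 : -1 / (τ : ℂ) / 2 = -(1 / 2 / τ) := by field_simp
  rw [h1, jacobiTheta₂_neg_left]
  have h2 : π * I * (-1 / (τ : ℂ)) / 4 = -π * I * (1 / 2) ^ 2 / τ := by field_simp; ring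
  rw [h2, K]
  ring

lemma exp_int_parity (x : ℂ) (m : ℤ) (hx : x = (2 * m : ℤ) * (π * I)) : cexp x = 1 := by
  rw [hx, Complex.exp_eq_one_iff]
  exact ⟨m, by push_cast; ring⟩

lemma t3_T (τ : ℍ) : t3 (T • τ) = t4 τ := by
  unfold t3 t4
  rw [coe_T]
  refine tsum_congr fun n => ?_
  unfold jacobiTheta₂_term
  obtain ⟨m, hm⟩ := Int.even_mul_pred_self n
  have hm' : (n : ℂ) * (n - 1) = m + m := by exact_mod_cast hm
  have : 2 * π * I * n * 0 + π * I * n ^ 2 * ((τ : ℂ) + 1) =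
    (2 * π * I * n * (1 / 2) + π * I * n ^ 2 * τ) + (2 * m : ℤ) * (π * I) := by
    push_cast
    linear_combination (π * I) * hm'
  rw [this, Complex.exp_add, exp_int_parity _ m rfl, mul_one]

lemma t4_T (τ : ℍ) : t4 (T • τ) = t3 τ := by
  rw [← t3_T]
  unfold t3
  rw [coe_T, coe_T, add_assoc, one_add_one_eq_two, jacobiTheta₂_add_right]

lemma t2_T (τ : ℍ) : t2 (T • τ) = cexp (π * I / 4) * t2 τ := by
  unfold t2
  rw [coe_T, ← mul_assoc, ← Complex.exp_add]
  congr 1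
  · congr 1
    ring
  refine tsum_congr fun n => ?_
  unfold jacobiTheta₂_term
  obtain ⟨m, hm⟩ := Int.even_mul_succ_self n
  have hm' : (n : ℂ) * (n + 1) = m + m := by exact_mod_cast hm
  have : 2 * π * I * n * (((τ : ℂ) + 1) / 2) + π * I * n ^ 2 * ((τ : ℂ) + 1) =
    (2 * π * I * n * (τ / 2) + π * I * n ^ 2 * τ) + (2 * m : ℤ) * (π * I) := by
    push_cast
    linear_combination (π * I) * hm'
  rw [this, Complex.exp_add, exp_int_parity _ m rfl, mul_one]

lemma zeta_pow4 : cexp (π * I / 4) ^ 4 = -1 := by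
  rw [← Complex.exp_nat_mul, ← Complex.exp_pi_mul_I]
  congr 1
  push_cast
  ring

lemma t2_T_pow4 (τ : ℍ) : t2 (T • τ) ^ 4 = - t2 τ ^ 4 := by
  rw [t2_T, mul_pow, zeta_pow4]
  ring

lemma mdiff_of_diff (f : ℂ → ℂ) (hf : ∀ z : ℂ, 0 < z.im → DifferentiableAt ℂ f z) :
    MDiff (fun τ : ℍ => f τ) := by
  intro τ
  exact (hf τ τ.2).mdifferentiableAt.comp τ τ.mdifferentiable_coe

lemma t3_mdiff : MDiff t3 :=
  mdiff_of_diff _ fun _ hz => differentiableAt_jacobiTheta₂_snd 0 hz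

lemma t4_mdiff : MDiff t4 :=
  mdiff_of_diff _ fun _ hz => differentiableAt_jacobiTheta₂_snd (1 / 2) hz

lemma t2_mdiff : MDiff t2 := by
  refine mdiff_of_diff (fun z => cexp (π * I * z / 4) * jacobiTheta₂ (z / 2) z) fun z hz => ?_
  refine DifferentiableAt.mul (by fun_prop) ?_
  have h := (hasFDerivAt_jacobiTheta₂ (z / 2) hz).differentiableAt
  exact DifferentiableAt.comp (f := fun z : ℂ => (z / 2, z)) z h (by fun_prop)

lemma Q_ne (τ : ℍ) : Q τ ≠ 0 := Complex.exp_ne_zero _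

lemma norm_Q (τ : ℍ) : ‖Q τ‖ = Real.exp (-π * τ.im) := by
  unfold Q
  rw [Complex.norm_exp]
  congr 1
  simp

lemma Q_tendsto : Tendsto Q atImInfty (𝓝 0) := by
  rw [tendsto_zero_iff_norm_tendsto_zero]
  simp only [norm_Q]
  refine Real.tendsto_exp_atBot.comp ?_
  have : Tendsto UpperHalfPlane.im atImInfty atTop := tendsto_comap
  exact this.const_mul_atTop_of_neg (by simpa using Real.pi_pos)

lemma Q2_tendsto : Tendsto (fun τ => Q τ ^ 2) atImInfty (𝓝 0) := by
  simpa using Q_tendsto.pow 2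

lemma E3.sq_var {f : ℍ → ℂ} {a b c : ℂ} (h : E3 (fun τ => Q τ ^ 2) f a b c) :
    E3 Q f a 0 b := by
  have h1 : (fun τ => f τ - (a + b * Q τ ^ 2 + c * (Q τ ^ 2) ^ 2)) =O[atImInfty]
      (fun τ => Q τ ^ 3) := by
    refine IsBigO.trans h ?_
    simp only [← pow_mul]
    exact pow_isBigO_pow Q_tendsto (by norm_num)
  have h2 : (fun τ => c * Q τ ^ 4) =O[atImInfty] (fun τ => Q τ ^ 3) :=
    (pow_isBigO_pow Q_tendsto (by norm_num)).const_mul_left _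
  refine (h1.add h2).congr_left fun τ => ?_
  ring

lemma summable_half_int (k : ℤ → ℕ) (hk : ∀ m, m.natAbs ≤ k m + 1) :
    Summable (fun m => (1 / 2 : ℝ) ^ k m) := by
  have h : Summable (fun m : ℤ => 2 * (1 / 2 : ℝ) ^ m.natAbs) := by
    refine Summable.mul_left _ ?_
    refine Summable.of_nat_of_neg ?_ ?_ <;> simpa using summable_geometric_two
  refine Summable.of_nonneg_of_le (fun _ => by positivity) (fun m => ?_) h
  have : (1 / 2 : ℝ) ^ (k m + 1) ≤ (1 / 2 : ℝ) ^ m.natAbs :=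
    pow_le_pow_of_le_one (by norm_num) (by norm_num) (hk m)
  rw [pow_succ] at this
  linarith

/-- triangular numbers -/
def tri (m : ℤ) : ℕ := (m * (m + 1) / 2).toNat

lemma tri_spec (m : ℤ) : 2 * (tri m : ℤ) = m * (m + 1) := by
  unfold tri
  have h1 : 0 ≤ m * (m + 1) := by
    rcases le_or_gt 0 m with h | h
    · positivity
    · nlinarith
  rw [Int.toNat_of_nonneg (by omega)]
  obtain ⟨k, hk⟩ := Int.even_mul_succ_self m
  omega

lemma tri_ge (m : ℤ) : m.natAbs ≤ tri m + 1 := by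
  have := tri_spec m
  zify
  rcases abs_cases m with ⟨h, _⟩ | ⟨h, _⟩ <;> rw [h] <;> nlinarith

lemma ncard_tri0 : {m | tri m = 0}.ncard = 2 := by
  have : {m | tri m = 0} = {0, -1} := by
    ext m
    have := tri_spec m
    simp only [Set.mem_ofPred_eq, Set.mem_insert_iff, Set.mem_singleton_iff]
    constructor
    · intro h
      rw [h] at this
      have : m * (m + 1) = 0 := by simpa using this.symm
      rcases mul_eq_zero.1 this with h | h
      · left; exact h
      · right; omega
    · rintro (rfl | rfl) <;> decide
  rw [this, Set.ncard_pair (by decide)]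

lemma ncard_tri1 : {m | tri m = 1}.ncard = 2 := by
  have : {m | tri m = 1} = {1, -2} := by
    ext m
    have := tri_spec m
    simp only [Set.mem_ofPred_eq, Set.mem_insert_iff, Set.mem_singleton_iff]
    constructor
    · intro h
      rw [h] at this
      have : (m - 1) * (m + 2) = 0 := by push_cast at this; linarith
      rcases mul_eq_zero.1 this with h | h
      · left; omega
      · right; omega
    · rintro (rfl | rfl) <;> decide
  rw [this, Set.ncard_pair (by decide)]

lemma ncard_tri2 : {m | tri m = 2}.ncard = 0 := by
  have : {m | tri m = 2} = ∅ := by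
    ext m
    have := tri_spec m
    simp only [Set.mem_ofPred_eq, Set.mem_empty_iff_false, iff_false]
    intro h
    rw [h] at this
    push_cast at this
    have h1 : m ≤ 1 ∨ 2 ≤ m := by omega
    have h2 : m ≤ -3 ∨ -2 ≤ m := by omega
    rcases h1 with h1 | h1
    · rcases h2 with h2 | h2
      · nlinarith
      · interval_cases m <;> omega
    · nlinarith
  rw [this, Set.ncard_empty]

/-- Even part of the theta constant. -/
def tA (τ : ℍ) : ℂ := ∑' m : ℤ, (Q τ ^ 2) ^ (2 * m.natAbs ^ 2)
/-- Odd part of the theta constant. -/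
def tB (τ : ℍ) : ℂ := ∑' m : ℤ, (Q τ ^ 2) ^ (4 * tri m)
/-- Normalised second theta constant. -/
def v2 (τ : ℍ) : ℂ := ∑' m : ℤ, (Q τ ^ 2) ^ (tri m)

lemma tA_exp : E3 (fun τ => Q τ ^ 2) tA 1 0 2 := by
  refine (expansion (fun τ => Q τ ^ 2) Q2_tendsto (fun m : ℤ => 2 * m.natAbs ^ 2) (1 / 2)
    (by norm_num) (summable_half_int _ fun m => ?_)).congr (fun _ => rfl) ?_ ?_ ?_
  · nlinarith [sq_nonneg ((m.natAbs : ℤ) - 1)]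
  · have : {m : ℤ | 2 * m.natAbs ^ 2 = 0} = {0} := by ext m; simp
    rw [this]; simp
  · have : {m : ℤ | 2 * m.natAbs ^ 2 = 1} = ∅ := by ext m; simp
    rw [this]; simp
  · have : {m : ℤ | 2 * m.natAbs ^ 2 = 2} = {1, -1} := by
      ext m; simp; omega
    rw [this, Set.ncard_pair (by decide)]; simp

lemma tB_exp : E3 (fun τ => Q τ ^ 2) tB 2 0 0 := by
  refine (expansion (fun τ => Q τ ^ 2) Q2_tendsto (fun m : ℤ => 4 * tri m) (1 / 2)
    (by norm_num) (summable_half_int _ fun m => ?_)).congr (fun _ => rfl) ?_ ?_ ?_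
  · have := tri_ge m
    omega
  · have : {m : ℤ | 4 * tri m = 0} = {m | tri m = 0} := by ext m; simp
    rw [this, ncard_tri0]; simp
  · have : {m : ℤ | 4 * tri m = 1} = ∅ := by ext m; simp
    rw [this]; simp
  · have : {m : ℤ | 4 * tri m = 2} = ∅ := by ext m; simp; omega
    rw [this]; simp

lemma v2_exp : E3 (fun τ => Q τ ^ 2) v2 2 2 0 := by
  refine (expansion (fun τ => Q τ ^ 2) Q2_tendsto (fun m : ℤ => tri m) (1 / 2)
    (by norm_num) (summable_half_int _ fun m => tri_ge m)).congr (fun _ => rfl) ?_ ?_ ?_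
  · rw [ncard_tri0]; simp
  · rw [ncard_tri1]; simp
  · rw [ncard_tri2]; simp

lemma t2_eq (τ : ℍ) : t2 τ = cexp (π * I * τ / 4) * v2 τ := by
  unfold t2 v2
  congr 1
  refine tsum_congr fun m => ?_
  unfold jacobiTheta₂_term Q
  rw [← pow_mul, ← Complex.exp_nat_mul]
  congr 1
  have h : (2 : ℂ) * (tri m : ℂ) = m * (m + 1) := by exact_mod_cast tri_spec m
  push_cast
  linear_combination (-(π * I * τ : ℂ)) * h

lemma t3_hasSum (τ : ℍ) : HasSum (fun n : ℤ => cexp (π * I * n ^ 2 * τ)) (t3 τ) := by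
  have := hasSum_jacobiTheta₂_term 0 τ.2
  refine this.congr_fun fun n => ?_
  simp [jacobiTheta₂_term]

lemma t4_hasSum (τ : ℍ) : HasSum (fun n : ℤ => cexp (π * I * n) * cexp (π * I * n ^ 2 * τ)) (t4 τ) := by
  have := hasSum_jacobiTheta₂_term (1 / 2) τ.2
  refine this.congr_fun fun n => ?_
  simp only [jacobiTheta₂_term]
  rw [← Complex.exp_add]
  congr 1
  ring

lemma exp_even (m : ℤ) : cexp (π * I * ((2 * m : ℤ) : ℂ)) = 1 :=
  exp_int_parity _ m (by ring)

lemma exp_odd (m : ℤ) : cexp (π * I * ((2 * m + 1 : ℤ) : ℂ)) = -1 := by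
  have : (π * I * ((2 * m + 1 : ℤ) : ℂ)) = π * I * ((2 * m : ℤ) : ℂ) + π * I := by
    push_cast; ring
  rw [this, Complex.exp_add, exp_even, Complex.exp_pi_mul_I, one_mul]

lemma two_tA (τ : ℍ) : 2 * tA τ = t3 τ + t4 τ := by
  rw [← ((t3_hasSum τ).add (t4_hasSum τ)).tsum_eq]
  have hg : Function.Injective (fun m : ℤ => 2 * m) := fun a b h => by simpa using h
  rw [← hg.tsum_eq]
  · unfold tA
    rw [← tsum_mul_left]
    refine tsum_congr fun m => ?_
    rw [exp_even, one_mul, ← two_mul]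
    congr 1
    unfold Q
    rw [← pow_mul, ← Complex.exp_nat_mul]
    congr 1
    have h : ((m.natAbs : ℂ)) ^ 2 = m ^ 2 := by
      have := congrArg (Int.cast : ℤ → ℂ) (Int.natAbs_sq m)
      push_cast at this
      simpa using this
    push_cast
    rw [h]
    ring
  · intro n hn
    rcases Int.even_or_odd' n with ⟨m, rfl | rfl⟩
    · exact ⟨m, rfl⟩
    · exfalso
      apply hn
      simp only
      rw [exp_odd]
      ring

lemma two_tB (τ : ℍ) : 2 * (Q τ * tB τ) = t3 τ - t4 τ := by
  rw [← ((t3_hasSum τ).sub (t4_hasSum τ)).tsum_eq]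
  have hg : Function.Injective (fun m : ℤ => 2 * m + 1) := fun a b h => by simpa using h
  rw [← hg.tsum_eq]
  · unfold tB
    rw [← tsum_mul_left, ← tsum_mul_left]
    refine tsum_congr fun m => ?_
    rw [exp_odd, neg_one_mul, sub_neg_eq_add, ← two_mul]
    congr 1
    unfold Q
    rw [← pow_mul, ← Complex.exp_nat_mul, ← Complex.exp_add]
    congr 1
    have h : (2 : ℂ) * (tri m : ℂ) = m * (m + 1) := by exact_mod_cast tri_spec m
    push_cast
    linear_combination (4 * π * I * τ : ℂ) * h
  · intro n hn
    rcases Int.even_or_odd' n with ⟨m, rfl | rfl⟩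
    · exfalso
      apply hn
      simp only
      rw [exp_even]
      ring
    · exact ⟨m, rfl⟩

lemma t3_eq (τ : ℍ) : t3 τ = tA τ + Q τ * tB τ := by
  linear_combination (-1 / 2) * two_tA τ - (1 / 2) * two_tB τ

lemma t4_eq (τ : ℍ) : t4 τ = tA τ + (-1) * (Q τ * tB τ) := by
  linear_combination (-1 / 2) * two_tA τ + (1 / 2) * two_tB τ

lemma t3_exp : E3 Q t3 1 2 0 :=
  (tA_exp.sq_var.add (E3.self.mul Q_tendsto tB_exp.sq_var)).congr t3_eq
    (by ring) (by ring) (by ring)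

lemma t4_exp : E3 Q t4 1 (-2) 0 :=
  (tA_exp.sq_var.add ((E3.self.mul Q_tendsto tB_exp.sq_var).const_mul Q_tendsto (-1))).congr t4_eq
    (by ring) (by ring) (by ring)

lemma t34_exp : ∃ c, E3 (fun τ => Q τ ^ 2) (fun τ => t3 τ * t4 τ) 1 (-4) c := by
  have hA := tA_exp.mul Q2_tendsto tA_exp
  have hB := (E3.self.mul Q2_tendsto (tB_exp.mul Q2_tendsto tB_exp)).const_mul Q2_tendsto (-1)
  refine ⟨_, (hA.add hB).congr (fun τ => ?_) (by ring) (by ring) rfl⟩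
  rw [t3_eq, t4_eq]
  ring

/-- `v2 / 2`. -/
def u2 (τ : ℍ) : ℂ := (1 / 2) * v2 τ

lemma u2_exp : E3 (fun τ => Q τ ^ 2) u2 1 1 0 :=
  (v2_exp.const_mul Q2_tendsto (1 / 2)).congr (fun _ => rfl) (by ring) (by ring) (by ring)

lemma t2_eq' (τ : ℍ) : t2 τ = 2 * (cexp (π * I * τ / 4) * u2 τ) := by
  rw [t2_eq, u2]
  ring

lemma t2_pow4 (τ : ℍ) : t2 τ ^ 4 = 16 * (Q τ * u2 τ ^ 4) := by
  rw [t2_eq', mul_pow, mul_pow, ← Complex.exp_nat_mul, Q]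
  have : ((4 : ℕ) : ℂ) * (π * I * τ / 4) = π * I * τ := by push_cast; ring
  rw [this]
  norm_num

/-- The product of the theta constants, eighth power. -/
def PP (τ : ℍ) : ℂ := (t2 τ * t3 τ * t4 τ) ^ 8

lemma PP_S (τ : ℍ) : PP (S • τ) = (τ : ℂ) ^ 12 * PP τ := by
  have hk := K_ne τ
  have h24 := K_pow24 τ
  have h0 : (τ : ℂ) ^ 12 ≠ 0 := pow_ne_zero _ τ.ne_zero
  have h : (τ : ℂ) ^ 12 = 1 / K τ ^ 24 := by rw [h24]; field_simp
  unfold PP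
  rw [t2_S, t3_S, t4_S, h]
  field_simp

lemma PP_T (τ : ℍ) : PP (T • τ) = PP τ := by
  unfold PP
  rw [t3_T, t4_T, mul_pow, mul_pow, show t2 (T • τ) ^ 8 = (t2 (T • τ) ^ 4) ^ 2 by ring, t2_T_pow4]
  ring

lemma t2_pow4_tendsto : Tendsto (fun τ => t2 τ ^ 4) atImInfty (𝓝 0) := by
  have := (Q_tendsto.mul ((u2_exp.tendsto Q2_tendsto).pow 4)).const_mul 16
  simp only [zero_mul, mul_zero] at this
  refine this.congr fun τ => (t2_pow4 τ).symm

lemma PP_tendsto : Tendsto PP atImInfty (𝓝 0) := by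
  have := ((t2_pow4_tendsto.pow 2).mul ((t3_exp.tendsto Q_tendsto).pow 8)).mul
    ((t4_exp.tendsto Q_tendsto).pow 8)
  have h0 : ((0 : ℂ) ^ 2 * 1 ^ 8 * 1 ^ 8) = 0 := by norm_num
  rw [h0] at this
  refine this.congr fun τ => ?_
  unfold PP
  ring

lemma PP_mdiff : MDiff PP := by
  have h : MDiff (fun τ => t2 τ * t3 τ * t4 τ) := (t2_mdiff.mul t3_mdiff).mul t4_mdiff
  have := (h.pow 8)
  exact this

lemma PP_ne (τ : ℍ) : PP τ ≠ 0 := by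
  have hinv : ∀ γ : SL(2, ℤ), PP ∣[(12 : ℤ)] γ = PP := by
    apply SlashInvariantForm.slash_action_generators_SL2Z
    · ext τ
      rw [ModularForm.SL_slash_apply, PP_S, ModularGroup.denom_S]
      have h0 := τ.ne_zero
      rw [zpow_neg]
      norm_cast
      field_simp
    · ext τ
      rw [ModularForm.SL_slash_apply, PP_T]
      rw [ModularGroup.denom_apply]
      simp [ModularGroup.T]
  let f : CuspForm 𝒮ℒ 12 :=
    { toFun := PP
      slash_action_eq' := fun _ ⟨γ, hγ⟩ ↦ hγ ▸ hinv γ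
      holo' := PP_mdiff
      zero_at_cusps' := by
        intro c hc
        rw [Subgroup.IsArithmetic.isCusp_iff_isCusp_SL2Z] at hc
        rw [OnePoint.isZeroAt_iff_forall_SL2Z hc]
        intro γ _
        rw [hinv γ]
        exact PP_tendsto }
  obtain ⟨c, hc⟩ := CuspForm.exists_smul_discriminant_of_weight_eq_twelve f
  have hc' : ∀ τ, c * ModularForm.discriminant τ = PP τ := fun τ =>
    congrFun (congrArg (DFunLike.coe (F := CuspForm 𝒮ℒ 12)) hc) τ
  have hc0 : c ≠ 0 := by
    rintro rfl
    have h3 := (t3_exp.tendsto Q_tendsto).eventually_ne one_ne_zero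
    have h4 := (t4_exp.tendsto Q_tendsto).eventually_ne one_ne_zero
    have h2 := (u2_exp.tendsto Q2_tendsto).eventually_ne one_ne_zero
    obtain ⟨σ, h3, h4, h2⟩ := (h3.and (h4.and h2)).exists
    have h := hc' σ
    rw [zero_mul] at h
    have : PP σ ≠ 0 := by
      unfold PP
      rw [t2_eq']
      have := Complex.exp_ne_zero (π * I * σ / 4)
      exact pow_ne_zero _ (mul_ne_zero (mul_ne_zero (mul_ne_zero two_ne_zero
        (mul_ne_zero this h2)) h3) h4)
    exact this h.symm
  rw [← hc']
  exact mul_ne_zero hc0 (ModularForm.discriminant_ne_zero τ)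

lemma t3_ne (τ : ℍ) : t3 τ ≠ 0 := by
  intro h; apply PP_ne τ; simp [PP, h]

lemma t2_ne (τ : ℍ) : t2 τ ≠ 0 := by
  intro h; apply PP_ne τ; simp [PP, h]

section Poisson

open MeasureTheory

variable {n : ℕ}

/-- Integer vector as a real vector. -/
def rv (k : Fin n → ℤ) : Fin n → ℝ := fun i => (k i : ℝ)

/-- Unit cube at an integer point. -/
def cube (k : Fin n → ℤ) : Set (Fin n → ℝ) := {v | ∀ i, v i ∈ Set.Ioc (k i : ℝ) (k i + 1)}

lemma cube_eq_pi (k : Fin n → ℤ) : cube k = Set.univ.pi fun i => Set.Ioc (k i : ℝ) (k i + 1) := by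
  ext v; simp [cube, Set.mem_pi]

lemma cube_meas (k : Fin n → ℤ) : MeasurableSet (cube k) := by
  rw [cube_eq_pi]
  exact MeasurableSet.univ_pi fun i => measurableSet_Ioc

lemma mem_cube_iff (k : Fin n → ℤ) (v : Fin n → ℝ) : v ∈ cube k ↔ ∀ i, ⌈v i⌉ = k i + 1 := by
  simp only [cube, Set.mem_ofPred_eq, Set.mem_Ioc]
  refine forall_congr' fun i => ?_
  rw [Int.ceil_eq_iff]
  push_cast
  rw [add_sub_cancel_right]

lemma cube_disj : Pairwise (Function.onFun Disjoint (cube (n := n))) := by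
  intro k l hkl
  rw [Function.onFun, Set.disjoint_left]
  intro v hk hl
  apply hkl
  rw [mem_cube_iff] at hk hl
  funext i
  have := hk i
  have := hl i
  omega

lemma cube_union : (⋃ k, cube (n := n) k) = Set.univ := by
  ext v
  simp only [Set.mem_iUnion, Set.mem_univ, iff_true]
  refine ⟨fun i => ⌈v i⌉ - 1, ?_⟩
  rw [mem_cube_iff]
  intro i; ring

lemma cube_shift {E : Type*} [NormedAddCommGroup E] [NormedSpace ℝ E] (f : (Fin n → ℝ) → E)
    (k : Fin n → ℤ) : ∫ v in cube k, f v = ∫ v in cube 0, f (v + rv k) := by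
  have h := (measurePreserving_add_right (volume : Measure (Fin n → ℝ)) (rv k)).setIntegral_preimage_emb
    (measurableEmbedding_addRight (rv k)) f (cube k)
  have hs : (fun x => x + rv k) ⁻¹' cube k = cube 0 := by
    ext v
    rw [Set.mem_preimage, mem_cube_iff, mem_cube_iff]
    refine forall_congr' fun i => ?_
    have : (v + rv k) i = v i + (k i : ℤ) := rfl
    rw [this, Int.ceil_add_intCast, Pi.zero_apply]
    omega
  rw [← h, hs]

lemma hasSum_cube {E : Type*} [NormedAddCommGroup E] [NormedSpace ℝ E]
    (f : (Fin n → ℝ) → E) (hf : Integrable f) :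
    HasSum (fun k => ∫ v in cube 0, f (v + rv k)) (∫ v, f v) := by
  have := hasSum_integral_iUnion (f := f) (μ := volume) (cube_meas (n := n)) cube_disj
    (by rw [cube_union]; exact hf.integrableOn)
  rw [cube_union, setIntegral_univ] at this
  exact this.congr_fun fun k => (cube_shift f k).symm

lemma integral_periodize (f : (Fin n → ℝ) → ℂ) (hf : Integrable f) :
    ∫ v in cube 0, ∑' k, f (v + rv k) = ∫ v, f v := by
  have h1 := hasSum_cube f hf
  have h2 := hasSum_cube (fun v => ‖f v‖) hf.norm
  have h3 := hasSum_integral_of_summable_integral_norm (μ := volume.restrict (cube (n := n) 0))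
    (F := fun k v => f (v + rv k)) (fun k => ?_) h2.summable
  · exact h3.unique h1
  · exact (hf.comp_add_right (rv k)).integrableOn

/-- the character -/
def ch (m : Fin n → ℤ) (v : Fin n → ℝ) : ℂ := cexp (2 * π * I * ∑ i, (m i : ℂ) * (v i : ℂ))

lemma ch_int (m k : Fin n → ℤ) (v : Fin n → ℝ) : ch m (v + rv k) = ch m v := by
  unfold ch
  have : 2 * π * I * ∑ i, (m i : ℂ) * ((v + rv k) i : ℝ) = 2 * π * I * ∑ i, (m i : ℂ) * (v i : ℝ) +
    (2 * (∑ i, m i * k i) : ℤ) * (π * I) := by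
    simp only [rv, Pi.add_apply]
    push_cast
    simp only [mul_add, Finset.sum_add_distrib]
    ring
  rw [this, Complex.exp_add, exp_int_parity _ _ rfl, mul_one]

lemma norm_ch (m : Fin n → ℤ) (v : Fin n → ℝ) : ‖ch m v‖ = 1 := by
  unfold ch
  have : 2 * π * I * ∑ i, (m i : ℂ) * (v i : ℝ) = ((2 * π * ∑ i, (m i : ℝ) * v i : ℝ) : ℂ) * I := by
    push_cast; ring
  rw [this, Complex.norm_exp_ofReal_mul_I]

lemma ch_continuous (m : Fin n → ℤ) : Continuous (ch m) := by
  unfold ch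
  fun_prop

lemma mFourier_coe (m : Fin n → ℤ) (v : Fin n → ℝ) :
    UnitAddTorus.mFourier m (fun i => (v i : UnitAddCircle)) = ch m v := by
  unfold ch
  simp only [UnitAddTorus.mFourier, ContinuousMap.coe_mk]
  rw [Finset.mul_sum, Complex.exp_sum]
  refine Finset.prod_congr rfl fun i _ => ?_
  rw [fourier_coe_apply]
  congr 1
  push_cast
  ring

/-- The projection to the torus. -/
def proj : C(Fin n → ℝ, UnitAddTorus (Fin n)) where
  toFun v := fun i => (v i : UnitAddCircle)
  continuous_toFun := by
    refine continuous_pi fun i => ?_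
    exact (AddCircle.continuous_mk' 1).comp (continuous_apply i)

lemma proj_quot : IsQuotientMap (proj (n := n)) := by
  have : IsOpenQuotientMap (Pi.map (fun (_ : Fin n) (x : ℝ) => (x : UnitAddCircle))) :=
    IsOpenQuotientMap.piMap fun i => QuotientAddGroup.isOpenQuotientMap_mk
  exact this.isQuotientMap

lemma proj_eq {v w : Fin n → ℝ} (h : proj v = proj w) : ∃ k, w = v + rv k := by
  have : ∀ i, ∃ k : ℤ, w i = v i + k := by
    intro i
    have h1 : (v i : UnitAddCircle) = (w i : UnitAddCircle) := congrFun h i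
    have h2 : ((w i - v i : ℝ) : UnitAddCircle) = 0 := by
      rw [AddCircle.coe_sub, h1, sub_self]
    obtain ⟨k, hk⟩ := AddCircle.coe_eq_zero_iff 1 |>.1 h2
    refine ⟨k, ?_⟩
    rw [zsmul_eq_mul, mul_one] at hk
    linarith
  choose k hk using this
  exact ⟨k, funext hk⟩

lemma poisson (f : (Fin n → ℝ) → ℂ) (hfi : Integrable f)
    (hG : Continuous (fun v => ∑' k : Fin n → ℤ, f (v + rv k)))
    (hc : Summable (fun m : Fin n → ℤ => ∫ v, ch (-m) v * f v)) (v : Fin n → ℝ) :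
    HasSum (fun m : Fin n → ℤ => (∫ v, ch (-m) v * f v) * ch m v) (∑' k, f (v + rv k)) := by
  let G : C(Fin n → ℝ, ℂ) := ⟨_, hG⟩
  have hper : ∀ v w, proj v = proj w → G v = G w := by
    intro v w h
    obtain ⟨k, rfl⟩ := proj_eq h
    change ∑' l, f (v + rv l) = ∑' l, f (v + rv k + rv l)
    rw [← (Equiv.addLeft k).tsum_eq]
    refine tsum_congr fun l => ?_
    congr 1
    ext i
    simp [rv]
    ring
  let g : C(UnitAddTorus (Fin n), ℂ) := proj_quot.lift G hper
  have hg : ∀ v, g (proj v) = G v := fun v =>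
    congrFun (congrArg DFunLike.coe (proj_quot.lift_comp G hper)) v
  have hcoef : UnitAddTorus.mFourierCoeff g = fun m : Fin n → ℤ => ∫ v, ch (-m) v * f v := by
    funext m
    rw [UnitAddTorus.mFourierCoeff_eq_integral _ _ 0]
    have hi : Integrable (fun v => ch (-m) v * f v) :=
      hfi.bdd_mul (ch_continuous _).aestronglyMeasurable (c := 1)
        (Filter.Eventually.of_forall fun v => (norm_ch _ _).le)
    rw [← integral_periodize _ hi]
    have hset : {x : Fin n → ℝ | ∀ i, x i ∈ Set.Ioc ((0 : Fin n → ℝ) i) ((0 : Fin n → ℝ) i + 1)} = cube 0 := by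
      ext x; simp [cube]
    rw [hset]
    refine integral_congr_ae (Filter.Eventually.of_forall fun v => ?_)
    simp only
    rw [mFourier_coe]
    have h1 : g (fun i => (v i : UnitAddCircle)) = G v := hg v
    rw [h1, smul_eq_mul]
    change ch (-m) v * ∑' l, f (v + rv l) = _
    rw [← tsum_mul_left]
    refine tsum_congr fun k => ?_
    rw [ch_int]
  have H := UnitAddTorus.hasSum_mFourier_series_apply_of_summable (f := g) (by rw [hcoef]; exact hc)
    (proj v)
  rw [hcoef, hg] at H
  refine H.congr_fun fun m => ?_
  have : UnitAddTorus.mFourier m (proj v) = ch m v := mFourier_coe m v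
  rw [this, smul_eq_mul]

end Poisson

section Lattice

open MeasureTheory

/-- Abbreviation for Euclidean space. -/
abbrev EE (n : ℕ) := EuclideanSpace ℝ (Fin n)

variable {n : ℕ} {L : Submodule ℤ (EuclideanSpace ℝ (Fin n))}

lemma exists_frame (hL : IsUnimodularLattice n L) :
    ∃ (A : (Fin n → ℝ) ≃L[ℝ] EE n) (eL : (Fin n → ℤ) ≃ L) (eD : (Fin n → ℤ) ≃ L),
      (∀ k, ((eL k : L) : EE n) = A (rv k)) ∧
      (∀ m v, ⟪((eD m : L) : EE n), A v⟫ = ∑ i, (m i : ℝ) * v i) := by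
  have : DiscreteTopology L := hL.1
  have : IsZLattice ℝ L := ⟨hL.2.1⟩
  have hr : Module.finrank ℤ L = n := by
    rw [ZLattice.rank ℝ L]; simp
  let b : Module.Basis (Fin n) ℤ L := Module.finBasisOfFinrankEq ℤ L hr
  let B := b.ofZLatticeBasis ℝ L
  let A : (Fin n → ℝ) ≃L[ℝ] EE n := B.equivFun.symm.toContinuousLinearEquiv
  have hA : ∀ v, A v = ∑ i, v i • B i := fun v => B.equivFun_symm_apply v
  have heL : ∀ k, ((b.equivFun.symm k : L) : EE n) = A (rv k) := by
    intro k
    rw [b.equivFun_symm_apply, hA]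
    push_cast
    refine Finset.sum_congr rfl fun i _ => ?_
    rw [Module.Basis.ofZLatticeBasis_apply, rv, Int.cast_smul_eq_zsmul]
  have key : ∀ m : Fin n → ℤ, ∃ x : L, ∀ v, ⟪(x : EE n), A v⟫ = ∑ i, (m i : ℝ) * v i := by
    intro m
    let φ : (Fin n → ℝ) →ₗ[ℝ] ℝ := Fintype.linearCombination ℝ (fun i => (m i : ℝ))
    let ψ : EE n →L[ℝ] ℝ := (LinearMap.toContinuousLinearMap φ).comp (A.symm : EE n →L[ℝ] (Fin n → ℝ))
    have hψ : ∀ v, ⟪(InnerProductSpace.toDual ℝ (EE n)).symm ψ, A v⟫ = ∑ i, (m i : ℝ) * v i := by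
      intro v
      rw [InnerProductSpace.toDual_symm_apply]
      simp [ψ, φ, Fintype.linearCombination_apply, mul_comm]
    refine ⟨⟨(InnerProductSpace.toDual ℝ (EE n)).symm ψ, ?_⟩, hψ⟩
    rw [hL.2.2]
    intro y hy
    obtain ⟨k, hk⟩ := b.equivFun.symm.surjective ⟨y, hy⟩
    have hy' : y = A (rv k) := by rw [← heL, hk]
    rw [hy', hψ]
    exact ⟨∑ i, m i * k i, by simp [rv]⟩
  choose D hD using key
  refine ⟨A, b.equivFun.symm.toEquiv, Equiv.ofBijective D ⟨?_, ?_⟩, heL, hD⟩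
  · intro m m' h
    funext i
    have h1 := hD m (Pi.single i 1)
    have h2 := hD m' (Pi.single i 1)
    rw [h, h2] at h1
    simpa [Pi.single_apply, eq_comm] using h1
  · intro x
    have hx := (hL.2.2 x).1 x.2
    choose m hm using fun i => hx (b i) (b i).2
    refine ⟨m, ?_⟩
    apply Subtype.ext
    refine ext_inner_right ℝ fun y => ?_
    obtain ⟨v, rfl⟩ := A.surjective y
    rw [hD, hA, inner_sum]
    refine Finset.sum_congr rfl fun i _ => ?_
    rw [inner_smul_right, Module.Basis.ofZLatticeBasis_apply, hm, mul_comm]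

lemma summable_gauss (hL : IsUnimodularLattice n L) (c : ℝ) (hc : 0 < c) :
    Summable (fun x : L => Real.exp (-c * ‖(x : EE n)‖ ^ 2)) := by
  have : DiscreteTopology L := hL.1
  set N := Module.finrank ℤ L + 1
  have h := ZLattice.summable_norm_pow_inv L (2 * N) (by omega)
  refine Summable.of_norm_bounded_eventually (h.mul_left (N.factorial / c ^ N)) ?_
  rw [Filter.eventually_cofinite]
  refine (Set.finite_singleton (0 : L)).subset fun x hx => ?_
  by_contra h0
  apply hx
  have hx0 : 0 < ‖(x : EE n)‖ := by
    rw [norm_pos_iff]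
    simpa using h0
  rw [Real.norm_eq_abs, abs_of_pos (Real.exp_pos _), neg_mul, Real.exp_neg]
  have h2 := Real.pow_div_factorial_le_exp (c * ‖(x : EE n)‖ ^ 2) (by positivity) N
  have h3 : (N.factorial / c ^ N : ℝ) * ‖x‖⁻¹ ^ (2 * N) = ((c * ‖(x : EE n)‖ ^ 2) ^ N / N.factorial)⁻¹ := by
    rw [mul_pow, ← pow_mul]
    have : ‖x‖ = ‖(x : EE n)‖ := rfl
    rw [this, inv_pow]
    field_simp
  rw [h3]
  exact inv_anti₀ (by positivity) h2

lemma norm_add_sq_ge (x u : EE n) : ‖x‖ ^ 2 / 2 - ‖u‖ ^ 2 ≤ ‖x + u‖ ^ 2 := by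
  have h : ‖x‖ ≤ ‖x + u‖ + ‖u‖ := by
    have := norm_sub_le (x + u) u
    simpa using this
  have h0 := norm_nonneg x
  nlinarith [sq_nonneg (‖x + u‖ - ‖u‖)]

lemma exp_shift_le (c R : ℝ) (hc : 0 ≤ c) (x u : EE n) (hu : ‖u‖ ≤ R) :
    Real.exp (-c * ‖x + u‖ ^ 2) ≤ Real.exp (c * R ^ 2) * Real.exp (-(c / 2) * ‖x‖ ^ 2) := by
  rw [← Real.exp_add]
  apply Real.exp_le_exp.2
  have h1 := norm_add_sq_ge x u
  have h2 : ‖u‖ ^ 2 ≤ R ^ 2 := by gcongr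
  nlinarith

lemma summable_gauss_shift (hL : IsUnimodularLattice n L) (c : ℝ) (hc : 0 < c) (u : EE n) :
    Summable (fun x : L => Real.exp (-c * ‖(x : EE n) + u‖ ^ 2)) := by
  have h := (summable_gauss hL (c / 2) (half_pos hc)).mul_left (Real.exp (c * ‖u‖ ^ 2))
  refine Summable.of_nonneg_of_le (fun x => ?_) (fun x => ?_) h
  · exact (Real.exp_pos _).le
  · exact exp_shift_le c ‖u‖ hc.le (x : EE n) u le_rfl

/-- Shifted lattice theta series. -/
def Th (L : Submodule ℤ (EuclideanSpace ℝ (Fin n))) (u : EE n) (z : ℂ) : ℂ :=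
  ∑' x : L, cexp (π * I * z * (‖(x : EE n) + u‖ ^ 2 : ℝ))

lemma norm_term (z : ℂ) (r : ℝ) : ‖cexp (π * I * z * (r : ℝ))‖ = Real.exp (-(π * z.im) * r) := by
  rw [Complex.norm_exp]
  congr 1
  simp

lemma Th_summable (hL : IsUnimodularLattice n L) (u : EE n) (z : ℂ) (hz : 0 < z.im) :
    Summable (fun x : L => cexp (π * I * z * (‖(x : EE n) + u‖ ^ 2 : ℝ))) := by
  apply Summable.of_norm
  simp only [norm_term]
  exact summable_gauss_shift hL _ (by positivity) u

lemma Th_continuous (hL : IsUnimodularLattice n L) (z : ℂ) (hz : 0 < z.im) :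
    Continuous (fun u => Th L u z) := by
  rw [continuous_iff_continuousAt]
  intro u₀
  have hball : Metric.ball (0 : EE n) (‖u₀‖ + 1) ∈ 𝓝 u₀ :=
    Metric.isOpen_ball.mem_nhds (by simp)
  refine ContinuousOn.continuousAt ?_ hball
  refine continuousOn_tsum (u := fun x : L => Real.exp (π * z.im * (‖u₀‖ + 1) ^ 2) *
    Real.exp (-(π * z.im / 2) * ‖(x : EE n)‖ ^ 2)) (fun x => ?_)
    ((summable_gauss hL _ (by positivity)).mul_left _) (fun x u hu => ?_)
  · fun_prop
  · rw [norm_term]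
    refine exp_shift_le _ _ (by positivity) _ _ ?_
    have : ‖u‖ < ‖u₀‖ + 1 := by simpa using hu
    exact this.le

lemma Th_mdiff (hL : IsUnimodularLattice n L) (u : EE n) : MDiff (fun τ : ℍ => Th L u τ) := by
  refine mdiff_of_diff (fun z => Th L u z) fun z hz => ?_
  have hU : IsOpen {w : ℂ | z.im / 2 < w.im} := isOpen_lt continuous_const Complex.continuous_im
  have hz2 : z ∈ {w : ℂ | z.im / 2 < w.im} := by
    change z.im / 2 < z.im
    linarith
  refine DifferentiableOn.differentiableAt ?_ (hU.mem_nhds hz2)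
  refine differentiableOn_tsum_of_summable_norm
    (summable_gauss_shift hL (π * (z.im / 2)) (by positivity) u) (fun x => ?_) hU (fun x w hw => ?_)
  · fun_prop
  · rw [norm_term]
    apply Real.exp_le_exp.2
    have : z.im / 2 < w.im := hw
    have hp := Real.pi_pos
    gcongr

end Lattice

section Theta

open MeasureTheory

variable {n : ℕ} {L : Submodule ℤ (EuclideanSpace ℝ (Fin n))}

lemma integral_lin (A : (Fin n → ℝ) ≃L[ℝ] EE n) : ∃ c : NNReal,
    (∀ f : EE n → ℂ, Integrable f → Integrable (fun v => f (A v))) ∧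
    (∀ f : EE n → ℂ, ∫ v, f (A v) = (c : ℂ) * ∫ x, f x) := by
  have h1 : (Measure.map A (volume : Measure (Fin n → ℝ))).IsAddHaarMeasure :=
    A.isAddHaarMeasure_map volume
  have h2 := Measure.isAddLeftInvariant_eq_smul (Measure.map A (volume : Measure (Fin n → ℝ)))
    (volume : Measure (EE n))
  set c := Measure.addHaarScalarFactor (Measure.map A (volume : Measure (Fin n → ℝ)))
    (volume : Measure (EE n))
  have he : MeasurableEmbedding A := A.toHomeomorph.measurableEmbedding
  refine ⟨c, fun f hf => ?_, fun f => ?_⟩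
  · have h3 : Integrable f (Measure.map A (volume : Measure (Fin n → ℝ))) := by
      rw [h2]
      exact hf.smul_measure_nnreal
    exact he.integrable_map_iff.1 h3
  · rw [← he.integral_map, h2, integral_smul_nnreal_measure]
    rfl

lemma K_pow_eq (τ : ℍ) (n : ℕ) : (π / (-(π * I * τ)) : ℂ) ^ ((n : ℂ) / 2) = K τ ^ n := by
  have hp : (π : ℂ) ≠ 0 := by exact_mod_cast Real.pi_ne_zero
  have h1 : (π / (-(π * I * τ)) : ℂ) = (-I * τ)⁻¹ := by
    have := τ.ne_zero
    field_simp
  have h2 : (-I * (τ : ℂ)).arg ≠ π := by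
    intro h
    rw [Complex.arg_eq_pi_iff] at h
    have h3 : (-I * (τ : ℂ)).re = τ.im := by simp
    have := τ.im_pos
    linarith [h.1]
  rw [h1, Complex.inv_cpow _ _ h2, K, one_div, inv_pow, ← Complex.cpow_nat_mul]
  congr 2
  ring

lemma theta_poisson_aux (hL : IsUnimodularLattice n L) : ∃ C : ℂ, ∀ (u : EE n) (τ : ℍ),
    Th L u τ = C * K τ ^ n * ∑' m : L, cexp (π * I * (-1 / τ) * (‖(m : EE n)‖ ^ 2 : ℝ)) *
      cexp (2 * π * I * (⟪(m : EE n), u⟫ : ℝ)) := by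
  obtain ⟨A, eL, eD, hA, hD⟩ := exists_frame hL
  obtain ⟨c, hc1, hc2⟩ := integral_lin A
  refine ⟨c, fun u τ => ?_⟩
  obtain ⟨v, rfl⟩ := A.surjective u
  set b : ℂ := -(π * I * τ) with hb
  have hbre : 0 < b.re := by
    have := τ.im_pos
    have hp := Real.pi_pos
    have : b.re = π * τ.im := by simp [hb]
    rw [this]; positivity
  let g : EE n → ℂ := fun x => cexp (-b * ‖x‖ ^ 2)
  have hg : Integrable g := by
    have := GaussianFourier.integrable_cexp_neg_mul_sq_norm_add hbre 0 (0 : EE n)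
    simpa [g] using this
  let f : (Fin n → ℝ) → ℂ := fun v => g (A v)
  have hsum : ∀ v, ∑' k : Fin n → ℤ, f (v + rv k) = Th L (A v) τ := by
    intro v
    rw [Th, ← eL.tsum_eq]
    refine tsum_congr fun k => ?_
    change cexp _ = _
    rw [hA, map_add, add_comm, hb]
    push_cast
    ring_nf
  have hco : ∀ m, ∫ v, ch (-m) v * f v =
      c * (K τ ^ n * cexp (π * I * (-1 / τ) * (‖((eD m : L) : EE n)‖ ^ 2 : ℝ))) := by
    intro m
    have h1 : ∀ v, ch (-m) v * f v =
        (fun x => cexp (↑(-2 * π * ⟪x, ((eD m : L) : EE n)⟫) * I) • g x) (A v) := by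
      intro v
      change _ = cexp _ • g (A v)
      rw [real_inner_comm, hD, smul_eq_mul, ch]
      congr 2
      push_cast
      simp only [Pi.neg_apply, Int.cast_neg, neg_mul, Finset.sum_neg_distrib]
      ring
    refine ((integral_congr_ae (Eventually.of_forall h1)).trans
      (hc2 (fun x => cexp (↑(-2 * π * ⟪x, ((eD m : L) : EE n)⟫) * I) • g x))).trans ?_
    rw [← Real.fourier_eq', fourier_gaussian_innerProductSpace hbre]
    simp only [finrank_euclideanSpace, Fintype.card_fin]
    rw [hb, K_pow_eq]
    congr 3
    have hp : (π : ℂ) ≠ 0 := by exact_mod_cast Real.pi_ne_zero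
    have := τ.ne_zero
    push_cast
    field_simp
    rw [I_sq]; ring
  have hs0 : Summable fun x : L => cexp (π * I * (-1 / τ) * (‖(x : EE n)‖ ^ 2 : ℝ)) := by
    have := Th_summable hL 0 ((S • τ : ℍ) : ℂ) (S • τ : ℍ).im_pos
    simpa only [add_zero, coe_S] using this
  have hP := poisson f (hc1 g hg) (by
    simp_rw [hsum]
    exact (Th_continuous hL τ τ.im_pos).comp A.continuous) (by
    simp_rw [hco]
    exact (((eD.summable_iff (f := fun x : L => cexp (π * I * (-1 / τ) *
      (‖(x : EE n)‖ ^ 2 : ℝ)))).2 hs0).mul_left _).mul_left _) v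
  rw [hsum] at hP
  rw [← hP.tsum_eq, ← eD.tsum_eq, ← tsum_mul_left]
  refine tsum_congr fun m => ?_
  rw [hco, hD, ch]
  push_cast
  ring

lemma Th_I_ne (hL : IsUnimodularLattice n L) (u : EE n) : Th L u I ≠ 0 := by
  have h : Th L u I = ((∑' x : L, Real.exp (-π * ‖(x : EE n) + u‖ ^ 2) : ℝ) : ℂ) := by
    rw [Th, Complex.ofReal_tsum]
    refine tsum_congr fun x => ?_
    push_cast
    congr 1
    linear_combination (π * (‖(x : EE n) + u‖ : ℂ) ^ 2) * I_sq
  rw [h]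
  have := (summable_gauss_shift hL π Real.pi_pos u).tsum_pos (fun x => (Real.exp_pos _).le) 0
    (Real.exp_pos _)
  exact_mod_cast this.ne'

lemma K_I : K UpperHalfPlane.I = 1 := by
  simp [K]

lemma theta_poisson (hL : IsUnimodularLattice n L) (u : EE n) (τ : ℍ) :
    Th L u τ = K τ ^ n * ∑' m : L, cexp (π * I * (-1 / τ) * (‖(m : EE n)‖ ^ 2 : ℝ)) *
      cexp (2 * π * I * (⟪(m : EE n), u⟫ : ℝ)) := by
  obtain ⟨C, hC⟩ := theta_poisson_aux hL
  have h := hC 0 UpperHalfPlane.I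
  have h2 : (∑' m : L, cexp (π * I * (-1 / (UpperHalfPlane.I : ℍ)) * (‖(m : EE n)‖ ^ 2 : ℝ)) *
      cexp (2 * π * I * (⟪(m : EE n), 0⟫ : ℝ))) = Th L 0 I := by
    rw [Th]
    refine tsum_congr fun x => ?_
    simp [neg_div]
  rw [h2, K_I] at h
  have h3 : C = 1 := by
    have := Th_I_ne hL 0
    have h4 : ((UpperHalfPlane.I : ℍ) : ℂ) = I := rfl
    rw [h4] at h
    field_simp at h
    simpa using h.symm
  rw [hC, h3, one_mul]

lemma theta_S (hL : IsUnimodularLattice n L) (τ : ℍ) :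
    Th L 0 (S • τ : ℍ) = Th L 0 τ / K τ ^ n := by
  rw [theta_poisson hL 0 τ, mul_div_cancel_left₀ _ (pow_ne_zero _ (K_ne τ)), Th, coe_S]
  refine tsum_congr fun x => ?_
  simp

lemma theta_TS (hL : IsUnimodularLattice n L) {w : EE n} (hw : IsCharacteristic n L w) (τ : ℍ) :
    Th L 0 (T • S • τ : ℍ) = Th L ((1 / 2 : ℝ) • w) τ / K τ ^ n := by
  rw [theta_poisson hL _ τ, mul_div_cancel_left₀ _ (pow_ne_zero _ (K_ne τ)), Th, coe_T, coe_S]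
  refine tsum_congr fun x => ?_
  obtain ⟨k, hk⟩ := hw.2 x x.2
  rw [real_inner_self_eq_norm_sq] at hk
  have h1 : (2 * π * I * (⟪(x : EE n), (1 / 2 : ℝ) • w⟫ : ℝ) : ℂ) =
      π * I * (‖(x : EE n)‖ ^ 2 : ℝ) + (2 * k : ℤ) * (π * I) := by
    rw [inner_smul_right, real_inner_comm, show ⟪w, (x : EE n)⟫ = ‖(x : EE n)‖ ^ 2 + 2 * k by linarith]
    push_cast
    ring
  rw [h1, Complex.exp_add (π * I * _), exp_int_parity _ k rfl, mul_one, ← Complex.exp_add, add_zero]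
  congr 1
  ring

lemma norm_sq_int (hL : IsUnimodularLattice n L) {x : EE n} (hx : x ∈ L) :
    ∃ k : ℕ, ‖x‖ ^ 2 = k := by
  obtain ⟨k, hk⟩ := (hL.2.2 x).1 hx x hx
  rw [real_inner_self_eq_norm_sq] at hk
  have h0 : 0 ≤ k := by
    have : (0 : ℝ) ≤ k := by rw [← hk]; positivity
    exact_mod_cast this
  lift k to ℕ using h0
  exact ⟨k, by rw [hk]; simp⟩

lemma theta_TT (hL : IsUnimodularLattice n L) (τ : ℍ) :
    Th L 0 (T • T • τ : ℍ) = Th L 0 τ := by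
  rw [Th, Th, coe_T, coe_T]
  refine tsum_congr fun x => ?_
  rw [add_zero]
  obtain ⟨k, hk⟩ := norm_sq_int hL x.2
  rw [hk]
  have : (π * I * (τ + 1 + 1) * (k : ℝ) : ℂ) = π * I * τ * (k : ℝ) + (2 * (k : ℤ) : ℤ) * (π * I) := by
    push_cast; ring
  rw [this, Complex.exp_add, exp_int_parity _ k rfl, mul_one]

lemma exists_char (hL : IsUnimodularLattice n L) : ∃ w, IsCharacteristic n L w := by
  obtain ⟨A, eL, eD, hA, hD⟩ := exists_frame hL
  -- the norm is linear modulo two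
  have hlin : ∀ m : Fin n → ℤ, ∀ s : Finset (Fin n), ∃ k : ℤ,
      ‖A (rv fun i => if i ∈ s then m i else 0)‖ ^ 2 =
        ∑ i ∈ s, (m i : ℝ) * ‖A (rv (Pi.single i 1))‖ ^ 2 + 2 * k := by
    intro m s
    induction s using Finset.induction_on with
    | empty =>
      refine ⟨0, ?_⟩
      have : (rv fun i : Fin n => if i ∈ (∅ : Finset (Fin n)) then m i else 0) = 0 := by
        funext i; simp [rv]
      rw [this]; simp
    | insert a s ha ih =>
      obtain ⟨k, hk⟩ := ih
      have h1 : (rv fun i => if i ∈ insert a s then m i else 0) =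
          (m a : ℝ) • rv (Pi.single a 1) + (rv fun i => if i ∈ s then m i else 0) := by
        funext i
        by_cases hi : i = a
        · subst hi
          simp [rv, ha]
        · simp [rv, hi]
      have h2 : A (rv (Pi.single a 1)) ∈ L := by rw [← hA]; exact (eL _).2
      have h3 : A (rv fun i => if i ∈ s then m i else 0) ∈ L := by rw [← hA]; exact (eL _).2
      obtain ⟨l, hl⟩ := (hL.2.2 _).1 h2 _ h3
      obtain ⟨r, hr⟩ := norm_sq_int hL h2
      obtain ⟨e, he⟩ := Int.even_mul_pred_self (m a)
      refine ⟨k + m a * l + e * r, ?_⟩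
      have he' : (m a : ℝ) * (m a - 1) = e + e := by exact_mod_cast he
      rw [h1, map_add, map_smul, norm_add_sq_real, hk, inner_smul_left, hl, Finset.sum_insert ha,
        norm_smul, mul_pow, hr]
      push_cast
      simp only [Real.norm_eq_abs, sq_abs, conj_trivial]
      linear_combination (r : ℝ) * he'
  choose r hr using fun i => norm_sq_int hL (x := A (rv (Pi.single i 1))) (by rw [← hA]; exact (eL _).2)
  refine ⟨eD (fun i => r i), (eD _).2, fun x hx => ?_⟩
  obtain ⟨m, hm⟩ := eL.surjective ⟨x, hx⟩
  have hx' : x = A (rv m) := by rw [← hA, hm]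
  obtain ⟨k, hk⟩ := hlin m Finset.univ
  simp only [Finset.mem_univ, if_true] at hk
  refine ⟨-k, ?_⟩
  rw [hx', hD, real_inner_self_eq_norm_sq, hk]
  simp only [hr]
  have : ∑ i, (((r i : ℤ) : ℝ)) * rv m i = ∑ i, (m i : ℝ) * r i :=
    Finset.sum_congr rfl fun i _ => by simp [rv, mul_comm]
  rw [this]
  push_cast
  ring

end Theta


section Blij

variable {n : ℕ} {L : Submodule ℤ (EuclideanSpace ℝ (Fin n))}

lemma char_diff (hL : IsUnimodularLattice n L) {w w' : EE n} (hw : IsCharacteristic n L w)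
    (hw' : IsCharacteristic n L w') : ∃ x ∈ L, w' = (2 : ℝ) • (x + (1 / 2 : ℝ) • w) := by
  refine ⟨(1 / 2 : ℝ) • (w' - w), ?_, ?_⟩
  · rw [hL.2.2]
    intro y hy
    obtain ⟨k, hk⟩ := hw.2 y hy
    obtain ⟨k', hk'⟩ := hw'.2 y hy
    refine ⟨k' - k, ?_⟩
    rw [inner_smul_left, inner_sub_left]
    push_cast
    simp only [conj_trivial]
    linarith
  · rw [← smul_add, smul_smul]
    norm_num

lemma char_add (hL : IsUnimodularLattice n L) {w x : EE n} (hw : IsCharacteristic n L w) (hx : x ∈ L) :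
    IsCharacteristic n L ((2 : ℝ) • (x + (1 / 2 : ℝ) • w)) := by
  have he : (2 : ℝ) • (x + (1 / 2 : ℝ) • w) = x + x + w := by
    rw [smul_add, smul_smul, two_smul]; norm_num
  rw [he]
  refine ⟨L.add_mem (L.add_mem hx hx) hw.1, fun y hy => ?_⟩
  obtain ⟨k, hk⟩ := hw.2 y hy
  obtain ⟨r, hr⟩ := (hL.2.2 x).1 hx y hy
  refine ⟨k + r, ?_⟩
  rw [inner_add_left, inner_add_left, hr]
  push_cast
  linarith

lemma norm_shift (hL : IsUnimodularLattice n L) {w x : EE n} (hw : IsCharacteristic n L w)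
    (hx : x ∈ L) : ∃ j : ℤ, ‖x + (1 / 2 : ℝ) • w‖ ^ 2 = ‖w‖ ^ 2 / 4 + 2 * j := by
  obtain ⟨k, hk⟩ := hw.2 x hx
  obtain ⟨r, hr⟩ := norm_sq_int hL hx
  rw [real_inner_self_eq_norm_sq, hr] at hk
  refine ⟨k + r, ?_⟩
  rw [norm_add_sq_real, inner_smul_right, real_inner_comm, norm_smul, hr, mul_pow]
  norm_num
  linarith

lemma psi_T (hL : IsUnimodularLattice n L) {w : EE n} (hw : IsCharacteristic n L w) (τ : ℍ) :
    Th L ((1 / 2 : ℝ) • w) (T • τ : ℍ) =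
      cexp (π * I * (‖w‖ ^ 2 / 4 : ℝ)) * Th L ((1 / 2 : ℝ) • w) τ := by
  rw [Th, Th, coe_T, ← tsum_mul_left]
  refine tsum_congr fun x => ?_
  obtain ⟨j, hj⟩ := norm_shift hL hw x.2
  rw [hj]
  have : (π * I * (τ + 1) * (‖w‖ ^ 2 / 4 + 2 * j : ℝ) : ℂ) = π * I * (‖w‖ ^ 2 / 4 : ℝ) +
    π * I * τ * (‖w‖ ^ 2 / 4 + 2 * j : ℝ) + (2 * j : ℤ) * (π * I) := by
    push_cast; ring
  rw [this, Complex.exp_add, exp_int_parity _ j rfl, mul_one, Complex.exp_add]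

lemma van_der_blij (hL : IsUnimodularLattice n L) {w : EE n} (hw : IsCharacteristic n L w) :
    ∃ j : ℤ, ‖w‖ ^ 2 = n + 8 * j := by
  let g : ℍ → ℂ := fun τ => Th L 0 τ / t3 τ ^ n
  have hT2 : ∀ τ, g (T • T • τ) = g τ := fun τ => by
    simp only [g, theta_TT hL, t3_T, t4_T]
  have hS : ∀ τ, g (S • τ) = g τ := fun τ => by
    have := K_ne τ
    simp only [g, theta_S hL, t3_S, div_pow]
    field_simp
  have hg : ∀ τ, g (T • S • τ) = Th L ((1 / 2 : ℝ) • w) τ / t2 τ ^ n := fun τ => by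
    have := K_ne τ
    simp only [g, theta_TS hL hw, t3_T, t4_S, div_pow]
    field_simp
  have h := inv_TST g hT2 hS UpperHalfPlane.I
  rw [hg, hg, psi_T hL hw, t2_T, mul_pow] at h
  have hp : Th L ((1 / 2 : ℝ) • w) (UpperHalfPlane.I : ℍ) ≠ 0 := Th_I_ne hL _
  have ht := t2_ne UpperHalfPlane.I
  have he : cexp (π * I / 4) ≠ 0 := Complex.exp_ne_zero _
  have h2 : cexp (π * I * (‖w‖ ^ 2 / 4 : ℝ)) = cexp (π * I / 4) ^ n := by
    field_simp at h
    exact h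
  rw [← Complex.exp_nat_mul, Complex.exp_eq_exp_iff_exists_int] at h2
  obtain ⟨j, hj⟩ := h2
  refine ⟨j, ?_⟩
  have hp : (π : ℂ) ≠ 0 := by exact_mod_cast Real.pi_ne_zero
  have h3 : ((‖w‖ ^ 2 / 4 : ℝ) : ℂ) = ((n / 4 + 2 * j : ℝ) : ℂ) := by
    have h4 : π * I * ((‖w‖ ^ 2 / 4 : ℝ) : ℂ) = π * I * ((n / 4 + 2 * j : ℝ) : ℂ) := by
      rw [hj]; push_cast; ring
    exact mul_left_cancel₀ (mul_ne_zero hp I_ne_zero) h4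
  have h5 : ‖w‖ ^ 2 / 4 = n / 4 + 2 * j := by exact_mod_cast h3
  linarith

end Blij


section Main

variable {n : ℕ} {L : Submodule ℤ (EuclideanSpace ℝ (Fin n))}

/-- The invariant function used to build the theta series. -/
def X (τ : ℍ) : ℂ := t2 τ ^ 4 * t4 τ ^ 4 / t3 τ ^ 8

lemma X_TT (τ : ℍ) : X (T • T • τ) = X τ := by
  simp only [X, t2_T_pow4, t4_T, t3_T, neg_neg]

lemma X_S (τ : ℍ) : X (S • τ) = X τ := by
  have := K_ne τ
  have := t3_ne τ
  simp only [X, t2_S, t4_S, t3_S]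
  field_simp

lemma X_TS (τ : ℍ) : X (T • S • τ) = -(t3 τ * t4 τ) ^ 4 / t2 τ ^ 8 := by
  have := K_ne τ
  have := t2_ne τ
  simp only [X, t2_T_pow4, t4_T, t3_T, t2_S, t4_S, t3_S]
  field_simp

lemma div_mdiff {f g : ℍ → ℂ} (hf : MDiff f) (hg : MDiff g) (h0 : ∀ τ, g τ ≠ 0) :
    MDiff (fun τ => f τ / g τ) := by
  rw [UpperHalfPlane.mdifferentiable_iff] at hf hg ⊢
  exact hf.div hg fun z _ => h0 _

lemma mul_mdiff {f g : ℍ → ℂ} (hf : MDiff f) (hg : MDiff g) :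
    MDiff (fun τ => f τ * g τ) := by
  rw [UpperHalfPlane.mdifferentiable_iff] at hf hg ⊢
  exact hf.mul hg

lemma pow_mdiff {f : ℍ → ℂ} (hf : MDiff f) (m : ℕ) :
    MDiff (fun τ => f τ ^ m) := by
  rw [UpperHalfPlane.mdifferentiable_iff] at hf ⊢
  exact hf.pow m

lemma comb_mdiff {f g : ℍ → ℂ} (hf : MDiff f) (hg : MDiff g) (c₁ c₂ : ℂ) :
    MDiff (fun τ : ℍ => (f τ - 1 - c₁ * g τ - c₂ * g τ ^ 2 : ℂ)) := by
  rw [UpperHalfPlane.mdifferentiable_iff] at hf hg ⊢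
  exact ((hf.sub_const 1).sub (hg.const_mul c₁)).sub ((hg.pow 2).const_mul c₂)

lemma X_mdiff : MDiff X :=
  div_mdiff (mul_mdiff (pow_mdiff t2_mdiff 4) (pow_mdiff t4_mdiff 4)) (pow_mdiff t3_mdiff 8)
    fun τ => pow_ne_zero _ (t3_ne τ)

lemma theta_exp (hL : IsUnimodularLattice n L) (h1 : ∀ x ∈ L, ⟪x, x⟫ ≠ (1 : ℝ)) :
    E3 Q (fun τ => Th L 0 τ) 1 0
      ({x : EE n | x ∈ L ∧ ⟪x, x⟫ = (2 : ℝ)}.ncard) := by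
  choose k hk using fun x : L => norm_sq_int hL x.2
  have hs : Summable fun x : L => (Real.exp (-1)) ^ k x := by
    refine (summable_gauss hL 1 one_pos).congr fun x => ?_
    rw [hk, ← Real.exp_nat_mul]
    congr 1
    ring
  refine (expansion Q Q_tendsto k _ (Real.exp_pos _) hs).congr (fun τ => ?_) ?_ ?_ ?_
  · rw [Th]
    refine tsum_congr fun x => ?_
    rw [add_zero, hk, Q, ← Complex.exp_nat_mul]
    congr 1
    push_cast
    ring
  · have : {x : L | k x = 0} = {0} := by
      ext x
      simp only [Set.mem_ofPred_eq, Set.mem_singleton_iff]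
      have h := hk x
      constructor
      · intro h0
        rw [h0] at h
        simpa using h
      · rintro rfl
        simpa using h.symm
    rw [this]; simp
  · have : {x : L | k x = 1} = ∅ := by
      ext x
      simp only [Set.mem_ofPred_eq, Set.mem_empty_iff_false, iff_false]
      intro h0
      apply h1 x x.2
      rw [real_inner_self_eq_norm_sq, hk, h0]
      simp
    rw [this]; simp
  · have : {x : EE n | x ∈ L ∧ ⟪x, x⟫ = (2 : ℝ)} = Subtype.val '' {x : L | k x = 2} := by
      ext x
      simp only [Set.mem_ofPred_eq, Set.mem_image]
      constructor
      · rintro ⟨hx, h2⟩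
        refine ⟨⟨x, hx⟩, ?_, rfl⟩
        have := hk ⟨x, hx⟩
        rw [← real_inner_self_eq_norm_sq] at this
        have h3 : ((k ⟨x, hx⟩ : ℕ) : ℝ) = 2 := by rw [← this]; exact h2
        exact_mod_cast h3
      · rintro ⟨y, hy, rfl⟩
        refine ⟨y.2, ?_⟩
        rw [real_inner_self_eq_norm_sq, hk, hy]
        norm_num
    rw [this, Set.ncard_image_of_injective _ Subtype.val_injective]

/-- The normalised shifted theta series. -/
def Ps (k : L → ℕ) (τ : ℍ) : ℂ := ∑' x : L, (Q τ ^ 2) ^ k x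

lemma psi_eq {w : EE n} (k : L → ℕ)
    (hk : ∀ x : L, ‖(x : EE n) + (1 / 2 : ℝ) • w‖ ^ 2 = ((n : ℝ) - 16) / 4 + 2 * k x) (τ : ℍ) :
    Th L ((1 / 2 : ℝ) • w) τ * cexp (π * I * τ / 4) ^ 16 = cexp (π * I * τ / 4) ^ n * Ps k τ := by
  rw [Th, Ps, ← tsum_mul_left, ← tsum_mul_right]
  refine tsum_congr fun x => ?_
  rw [hk, Q]
  simp only [← Complex.exp_nat_mul, ← Complex.exp_add]
  congr 1
  push_cast
  ring

lemma Ps_exp (hL : IsUnimodularLattice n L) {w : EE n} (k : L → ℕ)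
    (hk : ∀ x : L, ‖(x : EE n) + (1 / 2 : ℝ) • w‖ ^ 2 = ((n : ℝ) - 16) / 4 + 2 * k x) :
    ∃ a₁ a₂, E3 (fun τ => Q τ ^ 2) (Ps k) ({x : L | k x = 0}.ncard) a₁ a₂ := by
  have hs : Summable fun x : L => (Real.exp (-1)) ^ k x := by
    have h := (summable_gauss_shift hL (1 / 2) (by norm_num) ((1 / 2 : ℝ) • w)).mul_left
      (Real.exp (((n : ℝ) - 16) / 8))
    refine h.congr fun x => ?_
    rw [hk, ← Real.exp_nat_mul, ← Real.exp_add]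
    congr 1
    ring
  exact ⟨_, _, expansion (fun τ => Q τ ^ 2) Q2_tendsto k _ (Real.exp_pos _) hs⟩

lemma bound_aux (hL : IsUnimodularLattice n L) {w : EE n} (hw : IsCharacteristic n L w) (k : L → ℕ)
    (hk : ∀ x : L, ‖(x : EE n) + (1 / 2 : ℝ) • w‖ ^ 2 = ((n : ℝ) - 16) / 4 + 2 * k x)
    (c₁ c₂ c : ℂ)
    (hB : E3 (fun τ => Q τ ^ 2) (fun τ => 2 ^ 16 * (u2 τ ^ 16 * Ps k τ) +
          (-(2 ^ (n + 16)) * ((Q τ ^ 2 * Q τ ^ 2) * u2 τ ^ (n + 16)) +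
          (c₁ * 2 ^ (n + 8) * (Q τ ^ 2 * (u2 τ ^ (n + 8) * (t3 τ * t4 τ) ^ 4)) +
          -(c₂ * 2 ^ n) * (u2 τ ^ n * (t3 τ * t4 τ) ^ 8)))) 0 0 c) :
    IsBoundedAtImInfty (fun τ => Th L 0 (T • S • τ : ℍ) / t3 (T • S • τ) ^ n - 1 -
      c₁ * X (T • S • τ) - c₂ * X (T • S • τ) ^ 2) := by
  set B : ℍ → ℂ := (fun τ => 2 ^ 16 * (u2 τ ^ 16 * Ps k τ) +
          (-(2 ^ (n + 16)) * ((Q τ ^ 2 * Q τ ^ 2) * u2 τ ^ (n + 16)) +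
          (c₁ * 2 ^ (n + 8) * (Q τ ^ 2 * (u2 τ ^ (n + 8) * (t3 τ * t4 τ) ^ 4)) +
          -(c₂ * 2 ^ n) * (u2 τ ^ n * (t3 τ * t4 τ) ^ 8)))) with hBdef
  have hBO : B =O[atImInfty] (fun τ => (Q τ ^ 2) ^ 2) := by
    have h1 := IsBigO.trans hB (pow_isBigO_pow Q2_tendsto (show 2 ≤ 3 by norm_num))
    have h2 := (isBigO_refl (fun τ => (Q τ ^ 2) ^ 2) atImInfty).const_mul_left c
    refine (h1.add h2).congr_left fun τ => ?_
    ring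
  have hu : Tendsto (fun τ => (2 ^ (n + 16) * u2 τ ^ (n + 16))⁻¹) atImInfty
      (𝓝 (2 ^ (n + 16) * 1 ^ (n + 16))⁻¹) :=
    (((u2_exp.tendsto Q2_tendsto).pow (n + 16)).const_mul _).inv₀ (by simp)
  have h3 := (hBO.mul (isBigO_refl (fun τ => ((Q τ ^ 2) ^ 2)⁻¹) atImInfty)).mul (hu.isBigO_one ℂ)
  change _ =O[atImInfty] (1 : ℍ → ℝ)
  refine (h3.congr (f₂ := fun τ : ℍ => Th L 0 (T • S • τ : ℍ) / t3 (T • S • τ) ^ n - 1 -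
      c₁ * X (T • S • τ) - c₂ * X (T • S • τ) ^ 2) (g₂ := fun _ => (1 : ℂ))
      (fun τ => ?_) (fun τ => ?_)).trans (isBigO_const_const _ one_ne_zero _)
  · have hK := K_ne τ
    have hQ := Q_ne τ
    have ht := t2_ne τ
    have hu0 : u2 τ ≠ 0 := by
      intro h
      apply ht
      rw [t2_eq', h]; simp
    have he : cexp (π * I * τ / 4) ≠ 0 := Complex.exp_ne_zero _
    have hq : Q τ ^ 2 = cexp (π * I * τ / 4) ^ 8 := by
      rw [Q, ← Complex.exp_nat_mul, ← Complex.exp_nat_mul]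
      congr 1
      push_cast; ring
    have hψ := psi_eq k hk τ
    have hψ' : Th L ((1 / 2 : ℝ) • w) τ = cexp (π * I * τ / 4) ^ n * Ps k τ /
        cexp (π * I * τ / 4) ^ 16 := by
      rw [eq_div_iff (pow_ne_zero _ he), hψ]
    rw [theta_TS hL hw, X_TS, t3_T, t4_S, div_pow, hψ', t2_eq']
    simp only [hBdef]
    rw [hq]
    generalize cexp (π * I * τ / 4) = e at *
    have e1 : u2 τ ^ (n + 16) = u2 τ ^ n * u2 τ ^ 16 := pow_add _ _ _
    have e2 : u2 τ ^ (n + 8) = u2 τ ^ n * u2 τ ^ 8 := pow_add _ _ _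
    have e3 : (2 : ℂ) ^ (n + 16) = 2 ^ n * 2 ^ 16 := pow_add _ _ _
    have e4 : (2 : ℂ) ^ (n + 8) = 2 ^ n * 2 ^ 8 := pow_add _ _ _
    rw [e1, e2, e3, e4, mul_pow 2 _ n, mul_pow e _ n]
    field_simp
    ring
  · have hQ := Q_ne τ
    simp [hQ]

lemma main_identity (hL : IsUnimodularLattice n L) (h1 : ∀ x ∈ L, ⟪x, x⟫ ≠ (1 : ℝ))
    {w : EE n} (hw : IsCharacteristic n L w) (k : L → ℕ)
    (hk : ∀ x : L, ‖(x : EE n) + (1 / 2 : ℝ) • w‖ ^ 2 = ((n : ℝ) - 16) / 4 + 2 * k x) :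
    (({x : EE n | x ∈ L ∧ ⟪x, x⟫ = (2 : ℝ)}.ncard : ℕ) : ℂ) =
      2 * n * (23 - n) + 256 * (2 ^ 16 * ({x : L | k x = 0}.ncard : ℕ) / 2 ^ n) := by
  obtain ⟨a₁, a₂, hP⟩ := Ps_exp hL k hk
  obtain ⟨p, hp⟩ := t34_exp
  set A : ℂ := (({x : L | k x = 0}.ncard : ℕ) : ℂ) with hA
  set c₂ : ℂ := 2 ^ 16 * A / 2 ^ n with hc₂
  set c₁ : ℂ := (c₂ * 2 ^ n * ((n : ℂ) - 32) - 2 ^ 16 * (a₁ + 16 * A)) / 2 ^ (n + 8) with hc₁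
  have hc2' : c₂ * 2 ^ n = 2 ^ 16 * A := by
    rw [hc₂]; field_simp
  have hc1' : c₁ * 2 ^ (n + 8) = c₂ * 2 ^ n * ((n : ℂ) - 32) - 2 ^ 16 * (a₁ + 16 * A) := by
    rw [hc₁]; field_simp
  let f : ℍ → ℂ := fun τ => Th L 0 τ / t3 τ ^ n - 1 - c₁ * X τ - c₂ * X τ ^ 2
  have hθ := theta_exp hL h1
  have ht3 := t3_exp
  have ht4 := t4_exp
  have hu2 := u2_exp.sq_var
  have hx : E3 Q (fun τ => t2 τ ^ 4 * t4 τ ^ 4) 0 16 (-128) := by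
    refine (((E3.self.mul Q_tendsto (hu2.pow Q_tendsto 4)).mul Q_tendsto
      (ht4.pow Q_tendsto 4)).const_mul Q_tendsto 16).congr (fun τ => ?_) ?_ ?_ ?_
    · rw [t2_pow4]; ring
    all_goals ring
  have hzero : ∀ᶠ τ in atImInfty, f τ = 0 := by
    refine eventually_zero f ?_ ?_ ?_ ?_ ?_
    · exact comb_mdiff (div_mdiff (Th_mdiff hL 0) (pow_mdiff t3_mdiff n)
        fun τ => pow_ne_zero _ (t3_ne τ)) X_mdiff c₁ c₂
    · intro τ
      simp only [f, theta_TT hL, X_TT, t3_T, t4_T]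
    · intro τ
      have := K_ne τ
      have := t3_ne τ
      simp only [f, theta_S hL, X_S, t3_S, div_pow]
      congr 3
      field_simp
    · have h3 : Tendsto t3 atImInfty (𝓝 1) := ht3.tendsto Q_tendsto
      have hX : Tendsto X atImInfty (𝓝 0) := by
        have := (hx.tendsto Q_tendsto).div (h3.pow 8) (by simp)
        rw [zero_div] at this
        exact this
      have := ((((hθ.tendsto Q_tendsto).div (h3.pow n) (by simp)).sub_const 1).sub
        (hX.const_mul c₁)).sub ((hX.pow 2).const_mul c₂)
      simpa using this
    · -- boundedness at the other cusp
      have hB : E3 (fun τ => Q τ ^ 2) (fun τ => 2 ^ 16 * (u2 τ ^ 16 * Ps k τ) +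
          (-(2 ^ (n + 16)) * ((Q τ ^ 2 * Q τ ^ 2) * u2 τ ^ (n + 16)) +
          (c₁ * 2 ^ (n + 8) * (Q τ ^ 2 * (u2 τ ^ (n + 8) * (t3 τ * t4 τ) ^ 4)) +
          -(c₂ * 2 ^ n) * (u2 τ ^ n * (t3 τ * t4 τ) ^ 8)))) _ _ _ :=
        (((u2_exp.pow Q2_tendsto 16).mul Q2_tendsto hP).const_mul Q2_tendsto _).add
        ((((E3.self.mul Q2_tendsto E3.self).mul Q2_tendsto
          (u2_exp.pow Q2_tendsto (n + 16))).const_mul Q2_tendsto _).add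
        (((E3.self.mul Q2_tendsto ((u2_exp.pow Q2_tendsto (n + 8)).mul Q2_tendsto
          (hp.pow Q2_tendsto 4))).const_mul Q2_tendsto _).add
        (((u2_exp.pow Q2_tendsto n).mul Q2_tendsto (hp.pow Q2_tendsto 8)).const_mul
          Q2_tendsto _)))
      refine bound_aux hL hw k hk c₁ c₂ _ (hB.congr (fun _ => rfl) ?_ ?_ rfl)
      · linear_combination hc2'
      · push_cast
        linear_combination -hc1'
  have hN : E3 Q (fun τ => Th L 0 τ * t3 τ ^ 16 + (-1 * t3 τ ^ (n + 16) +
      (-c₁ * (t3 τ ^ (n + 8) * (t2 τ ^ 4 * t4 τ ^ 4)) +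
      -c₂ * (t3 τ ^ n * ((t2 τ ^ 4 * t4 τ ^ 4) * (t2 τ ^ 4 * t4 τ ^ 4)))))) _ _ _ :=
    (hθ.mul Q_tendsto (ht3.pow Q_tendsto 16)).add
    (((ht3.pow Q_tendsto (n + 16)).const_mul Q_tendsto _).add
    ((((ht3.pow Q_tendsto (n + 8)).mul Q_tendsto hx).const_mul Q_tendsto _).add
    (((ht3.pow Q_tendsto n).mul Q_tendsto (hx.mul Q_tendsto hx)).const_mul Q_tendsto _)))
  have hN0 : E3 Q (fun τ => Th L 0 τ * t3 τ ^ 16 + (-1 * t3 τ ^ (n + 16) +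
      (-c₁ * (t3 τ ^ (n + 8) * (t2 τ ^ 4 * t4 τ ^ 4)) +
      -c₂ * (t3 τ ^ n * ((t2 τ ^ 4 * t4 τ ^ 4) * (t2 τ ^ 4 * t4 τ ^ 4)))))) 0 0 0 := by
    unfold E3
    refine IsBigO.congr' (isBigO_zero (fun τ => Q τ ^ 3) atImInfty) ?_ (EventuallyEq.refl _ _)
    filter_upwards [hzero] with τ hτ
    have := t3_ne τ
    simp only [f, X] at hτ
    field_simp at hτ
    have e1 : t3 τ ^ (n + 16) = t3 τ ^ n * t3 τ ^ 16 := pow_add _ _ _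
    have e2 : t3 τ ^ (n + 8) = t3 τ ^ n * t3 τ ^ 8 := pow_add _ _ _
    rw [e1, e2]
    linear_combination -hτ
  obtain ⟨-, hb, hc⟩ := hN.unique Q_tendsto Q_ne hN0
  push_cast at hb hc
  linear_combination hc - (2 * n + 8) * hb

end Main


end

end LS


/-- For a unimodular lattice in `ℝⁿ` with no vectors of norm 1, the number `N₂` of
vectors of norm 2 equals `2n(23 − n)` iff every characteristic vector has norm at
least `n − 8`. -/
theorem card_norm_two_eq_iff (n : ℕ) (L : Submodule ℤ (EuclideanSpace ℝ (Fin n)))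
    (hL : IsUnimodularLattice n L)
    (h1 : ∀ x ∈ L, ⟪x, x⟫ ≠ (1 : ℝ)) :
    (({x : EuclideanSpace ℝ (Fin n) | x ∈ L ∧ ⟪x, x⟫ = (2 : ℝ)}.ncard : ℤ) =
        2 * (n : ℤ) * (23 - (n : ℤ))) ↔
      ∀ w : EuclideanSpace ℝ (Fin n), IsCharacteristic n L w →
        (n : ℝ) - 8 ≤ ⟪w, w⟫ := by
  obtain ⟨w, hw⟩ := LS.exists_char hL
  have hhalf : ∀ v : EuclideanSpace ℝ (Fin n), ‖(2 : ℝ) • v‖ ^ 2 = 4 * ‖v‖ ^ 2 := by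
    intro v
    rw [norm_smul, mul_pow]; norm_num
  -- under the weak bound we have the main identity
  have hmain : (∀ v, IsCharacteristic n L v → (n : ℝ) - 16 ≤ ‖v‖ ^ 2) → ∃ A : ℕ,
      (({x : EuclideanSpace ℝ (Fin n) | x ∈ L ∧ ⟪x, x⟫ = (2 : ℝ)}.ncard : ℕ) : ℂ) =
        2 * n * (23 - n) + 256 * (2 ^ 16 * A / 2 ^ n) ∧
      (A = 0 ↔ ∀ v, IsCharacteristic n L v → (n : ℝ) - 8 ≤ ‖v‖ ^ 2) := by
    intro hmin
    have hk : ∀ x : L, ∃ k : ℕ,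
        ‖(x : EuclideanSpace ℝ (Fin n)) + (1 / 2 : ℝ) • w‖ ^ 2 = ((n : ℝ) - 16) / 4 + 2 * k := by
      intro x
      have hc := LS.char_add hL hw x.2
      obtain ⟨j, hj⟩ := LS.van_der_blij hL hc
      have hm := hmin _ hc
      rw [hj] at hm
      have hj0 : 0 ≤ j + 2 := by
        have : (0 : ℝ) ≤ ((j + 2 : ℤ) : ℝ) := by push_cast; linarith
        exact_mod_cast this
      rw [hhalf] at hj
      refine ⟨(j + 2).toNat, ?_⟩
      have : (((j + 2).toNat : ℕ) : ℝ) = ((j + 2 : ℤ) : ℝ) := by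
        exact_mod_cast congrArg (fun z : ℤ => (z : ℝ)) (Int.toNat_of_nonneg hj0)
      rw [this]
      push_cast
      linarith
    choose k hk using hk
    refine ⟨{x : L | k x = 0}.ncard, LS.main_identity hL h1 hw k hk, ?_⟩
    have hs : Summable fun x : L => (Real.exp (-1)) ^ k x := by
      have h := (LS.summable_gauss_shift hL (1 / 2) (by norm_num) ((1 / 2 : ℝ) • w)).mul_left
        (Real.exp (((n : ℝ) - 16) / 8))
      refine h.congr fun x => ?_
      rw [hk, ← Real.exp_nat_mul, ← Real.exp_add]
      congr 1
      ring
    rw [Set.ncard_eq_zero (LS.finite_fiber k _ (Real.exp_pos _) hs 0)]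
    constructor
    · intro he v hv
      obtain ⟨x, hx, rfl⟩ := LS.char_diff hL hw hv
      rw [hhalf, hk ⟨x, hx⟩]
      have h0 : k ⟨x, hx⟩ ≠ 0 := by
        intro h0
        have : (⟨x, hx⟩ : L) ∈ {x : L | k x = 0} := h0
        rw [he] at this
        exact this
      have h2 : (1 : ℝ) ≤ k ⟨x, hx⟩ := by exact_mod_cast Nat.one_le_iff_ne_zero.2 h0
      linarith
    · intro h
      ext x
      simp only [Set.mem_ofPred_eq, Set.mem_empty_iff_false, iff_false]
      intro h0
      have h3 := h _ (LS.char_add hL hw x.2)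
      rw [hhalf, hk, h0] at h3
      push_cast at h3
      linarith
  simp only [real_inner_self_eq_norm_sq] at hmain ⊢
  constructor
  · intro hN
    have hn : n ≤ 23 := by
      by_contra hn
      push Not at hn
      have h0 : (0 : ℤ) ≤ 2 * (n : ℤ) * (23 - (n : ℤ)) := by rw [← hN]; positivity
      have : (0 : ℤ) < n := by omega
      nlinarith
    obtain ⟨A, hA1, hA2⟩ := hmain (by
      intro v hv
      obtain ⟨j, hj⟩ := LS.van_der_blij hL hv
      have h0 : (0 : ℝ) ≤ n + 8 * j := by rw [← hj]; positivity
      have h1 : (0 : ℤ) ≤ n + 8 * j := by exact_mod_cast h0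
      have h2 : -2 ≤ j := by omega
      have h3 : (-2 : ℝ) ≤ j := by exact_mod_cast h2
      rw [hj]; linarith)
    refine hA2.1 ?_
    have hN' : (({x : EuclideanSpace ℝ (Fin n) | x ∈ L ∧ ‖x‖ ^ 2 = (2 : ℝ)}.ncard : ℕ) : ℂ) =
        2 * n * (23 - n) := by exact_mod_cast congrArg (fun z : ℤ => (z : ℂ)) hN
    rw [hN'] at hA1
    have h4 : (256 * (2 ^ 16 * A / 2 ^ n) : ℂ) = 0 := by linear_combination -hA1
    simpa using h4
  · intro h
    obtain ⟨A, hA1, hA2⟩ := hmain fun v hv => by linarith [h v hv]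
    rw [hA2.2 h] at hA1
    have h5 : (({x : EuclideanSpace ℝ (Fin n) | x ∈ L ∧ ‖x‖ ^ 2 = (2 : ℝ)}.ncard : ℕ) : ℂ) =
        2 * n * (23 - n) := by
      rw [hA1]; simp
    exact_mod_cast h5
end
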